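/- arXiv:2210.03805 — 3 statements merged into one kernel-verified Lean document; each statement's English description precedes it below -/
import Mathlib

section
/- Large deviations for non-stationary random matrix products. Assume that the compact set K of Borel probability measures on SL(d,ℝ) satisfies the finite moment condition, the measures condition, and the spaces condition. Then for any ε > 0 there exists δ > 0 and N such that for all n ≥ N (with N depending only on ε and K, uniformly over all choices of μ₁, …, μₙ ∈ K and over all unit vectors v₀ ∈ ℝ^d), with ℙ = μ₁ × ⋯ × μₙ one has ℙ{ |log‖Tₙ‖ − Lₙ| > εn } < e^{−δn} and ℙ{ |log|Tₙ v₀| − Lₙ| > εn } < e^{−δn}. -/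
open MeasureTheory Matrix Filter
open scoped ENNReal

noncomputable section

/-- `SL(d, ℝ)`. -/
abbrev SL (d : ℕ) := Matrix.SpecialLinearGroup (Fin d) ℝ

instance (d : ℕ) : TopologicalSpace (SL d) :=
  inferInstanceAs (TopologicalSpace { A : Matrix (Fin d) (Fin d) ℝ // A.det = 1 })

instance (d : ℕ) : MeasurableSpace (SL d) := borel _
instance (d : ℕ) : BorelSpace (SL d) := ⟨rfl⟩

/-- Operator norm of a real `d × d` matrix, acting on Euclidean space. -/
def opNorm {d : ℕ} (A : Matrix (Fin d) (Fin d) ℝ) : ℝ :=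
  ‖Matrix.toEuclideanCLM (𝕜 := ℝ) A‖

/-- The norm `‖A‖` of `A ∈ SL(d, ℝ)`. -/
def slNorm {d : ℕ} (A : SL d) : ℝ := opNorm (A : Matrix (Fin d) (Fin d) ℝ)

/-- `A` applied to a vector `v ∈ ℝ^d` (with the Euclidean norm). -/
def slVec {d : ℕ} (A : SL d) (v : EuclideanSpace ℝ (Fin d)) : EuclideanSpace ℝ (Fin d) :=
  Matrix.toEuclideanCLM (𝕜 := ℝ) (A : Matrix (Fin d) (Fin d) ℝ) v

/-- The random (reversed) product `Tₙ = Aₙ ⋯ A₂ A₁`, where `Aᵢ = ω (i-1)`. -/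
def T {d : ℕ} (ω : ℕ → SL d) : ℕ → SL d
  | 0 => 1
  | n + 1 => ω n * T ω n

/-- The projective space `ℝP^{d-1}`. -/
abbrev Proj (d : ℕ) := Projectivization ℝ (Fin d → ℝ)

instance (d : ℕ) : TopologicalSpace (Proj d) :=
  inferInstanceAs (TopologicalSpace (Quotient (projectivizationSetoid ℝ (Fin d → ℝ))))

instance (d : ℕ) : MeasurableSpace (Proj d) := borel _
instance (d : ℕ) : BorelSpace (Proj d) := ⟨rfl⟩

/-- The linear map induced by `A ∈ SL(d, ℝ)` is injective. -/
theorem toLin'_injective {d : ℕ} (A : SL d) :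
    Function.Injective (Matrix.toLin' (A : Matrix (Fin d) (Fin d) ℝ)) := by
  apply Function.LeftInverse.injective
    (g := Matrix.toLin' ((A⁻¹ : SL d) : Matrix (Fin d) (Fin d) ℝ))
  intro x
  rw [← Matrix.toLin'_mul_apply, ← Matrix.SpecialLinearGroup.coe_mul, inv_mul_cancel,
    Matrix.SpecialLinearGroup.coe_one, Matrix.toLin'_one, LinearMap.id_apply]

/-- The projective map `f_A : ℝP^{d-1} → ℝP^{d-1}` induced by `A ∈ SL(d, ℝ)`. -/
def projMap {d : ℕ} (A : SL d) : Proj d → Proj d :=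
  Projectivization.map (Matrix.toLin' (A : Matrix (Fin d) (Fin d) ℝ)) (toLin'_injective A)

/-- The subset `[L] ⊆ ℝP^{d-1}` corresponding to a linear subspace `L ≤ ℝ^d`. -/
def projSet {d : ℕ} (L : Submodule ℝ (Fin d → ℝ)) : Set (Proj d) :=
  {x : Proj d | x.submodule ≤ L}

/-- Finite moment condition for a single measure, with exponent `γ` and bound `C`. -/
def FiniteMomentCondition {d : ℕ} (γ C : ℝ) (μ : ProbabilityMeasure (SL d)) : Prop :=
  ∫⁻ A, ENNReal.ofReal (slNorm A ^ γ) ∂(μ : Measure (SL d)) < ENNReal.ofReal C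

/-- Log-moment condition: `∫ log ‖A‖ dμ(A) < ∞`. -/
def LogMomentCondition {d : ℕ} (μ : ProbabilityMeasure (SL d)) : Prop :=
  ∫⁻ A, ENNReal.ofReal (Real.log (slNorm A)) ∂(μ : Measure (SL d)) < ⊤

/-- Measures condition: there are no Borel probability measures `ν₁`, `ν₂` on `ℝP^{d-1}`
with `(f_A)_* ν₁ = ν₂` for `μ`-a.e. `A`. -/
def MeasuresCondition {d : ℕ} (μ : ProbabilityMeasure (SL d)) : Prop :=
  ¬ ∃ (ν₁ ν₂ : ProbabilityMeasure (Proj d)),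
      ∀ᵐ A ∂(μ : Measure (SL d)),
        (ν₁ : Measure (Proj d)).map (projMap A) = (ν₂ : Measure (Proj d))

/-- `U ⊆ ℝ^d` is a (nonempty) finite union of proper nonzero linear subspaces. -/
def IsFiniteUnionOfProperSubspaces {d : ℕ} (U : Set (Fin d → ℝ)) : Prop :=
  ∃ S : Set (Submodule ℝ (Fin d → ℝ)), S.Finite ∧ S.Nonempty ∧
    (∀ W ∈ S, W ≠ ⊥ ∧ W ≠ ⊤) ∧ U = ⋃ W ∈ S, (W : Set (Fin d → ℝ))

/-- `U ⊆ ℝ^d` is a (nonempty) finite union of `j`-dimensional linear subspaces. -/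
def IsFiniteUnionOfDimSubspaces {d : ℕ} (j : ℕ) (U : Set (Fin d → ℝ)) : Prop :=
  ∃ S : Set (Submodule ℝ (Fin d → ℝ)), S.Finite ∧ S.Nonempty ∧
    (∀ W ∈ S, Module.finrank ℝ W = j) ∧ U = ⋃ W ∈ S, (W : Set (Fin d → ℝ))

/-- Spaces condition: there are no two finite unions `U`, `U'` of proper nonzero subspaces
of `ℝ^d` such that `A(U) = U'` for `μ`-a.e. `A`. -/
def SpacesCondition {d : ℕ} (μ : ProbabilityMeasure (SL d)) : Prop :=
  ¬ ∃ U U' : Set (Fin d → ℝ), IsFiniteUnionOfProperSubspaces U ∧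
      IsFiniteUnionOfProperSubspaces U' ∧
      ∀ᵐ (A : SL d) ∂(μ : Measure (SL d)),
        (fun v => Matrix.toLin' (A : Matrix (Fin d) (Fin d) ℝ) v) '' U = U'

/-- `ℙ` is the product measure `μ₁ × μ₂ × ⋯` on sequences, characterized by its
finite-dimensional marginals. -/
def IsProductMeasure {d : ℕ} (μ : ℕ → ProbabilityMeasure (SL d))
    (ℙ : Measure (ℕ → SL d)) : Prop :=
  IsProbabilityMeasure ℙ ∧
    ∀ n : ℕ, ℙ.map (fun ω (i : Fin n) => ω i) =
      Measure.pi (fun i : Fin n => ((μ i : Measure (SL d))))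

/-- `Lₙ = E log ‖Tₙ‖`. -/
def L {d : ℕ} (ℙ : Measure (ℕ → SL d)) (n : ℕ) : ℝ :=
  ∫ ω, Real.log (slNorm (T ω n)) ∂ℙ

/-- `L_{[n,m]} = E log ‖A_m ⋯ A_{n+1}‖`. -/
def Lseg {d : ℕ} (ℙ : Measure (ℕ → SL d)) (n m : ℕ) : ℝ :=
  ∫ ω, Real.log (slNorm (T ω m * (T ω n)⁻¹)) ∂ℙ

/-! ### Topology of `SL(d, ℝ)` and its action on Euclidean space -/

theorem continuous_sl_coe {d : ℕ} :
    Continuous (fun A : SL d => (A : Matrix (Fin d) (Fin d) ℝ)) :=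
  continuous_subtype_val

theorem continuous_sl_iff {d : ℕ} {X : Type*} [TopologicalSpace X] {f : X → SL d} :
    Continuous f ↔ Continuous (fun x => (f x : Matrix (Fin d) (Fin d) ℝ)) :=
  Topology.IsInducing.subtypeVal.continuous_iff

instance (d : ℕ) : SecondCountableTopology (SL d) :=
  inferInstanceAs (SecondCountableTopology { A : Fin d → Fin d → ℝ // Matrix.det A = 1 })

instance (d : ℕ) : TopologicalSpace.MetrizableSpace (SL d) :=
  inferInstanceAs (TopologicalSpace.MetrizableSpace { A : Fin d → Fin d → ℝ // Matrix.det A = 1 })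

instance (d : ℕ) : ContinuousMul (SL d) :=
  ⟨continuous_sl_iff.2 <| by
    simp only [Matrix.SpecialLinearGroup.coe_mul]
    exact (continuous_sl_coe.comp continuous_fst).matrix_mul (continuous_sl_coe.comp continuous_snd)⟩

instance (d : ℕ) : ContinuousInv (SL d) :=
  ⟨continuous_sl_iff.2 <| by
    simp only [Matrix.SpecialLinearGroup.coe_inv]
    exact continuous_sl_coe.matrix_adjugate⟩

/-- The action of `A` on Euclidean space as a continuous linear map. -/
def slCLM {d : ℕ} (A : SL d) : EuclideanSpace ℝ (Fin d) →L[ℝ] EuclideanSpace ℝ (Fin d) :=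
  Matrix.toEuclideanCLM (𝕜 := ℝ) (A : Matrix (Fin d) (Fin d) ℝ)

theorem slVec_eq {d : ℕ} (A : SL d) (v : EuclideanSpace ℝ (Fin d)) : slVec A v = slCLM A v := rfl

theorem slNorm_eq {d : ℕ} (A : SL d) : slNorm A = ‖slCLM A‖ := rfl

theorem slCLM_mul {d : ℕ} (A B : SL d) : slCLM (A * B) = slCLM A * slCLM B := by
  simp [slCLM]

theorem slCLM_one {d : ℕ} : slCLM (1 : SL d) = 1 := by
  simp [slCLM]

theorem slVec_mul {d : ℕ} (A B : SL d) (v : EuclideanSpace ℝ (Fin d)) :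
    slVec (A * B) v = slVec A (slVec B v) := by
  simp [slVec_eq, slCLM_mul]

theorem slVec_one {d : ℕ} (v : EuclideanSpace ℝ (Fin d)) : slVec (1 : SL d) v = v := by
  simp [slVec_eq, slCLM_one]

theorem slVec_inv_slVec {d : ℕ} (A : SL d) (v : EuclideanSpace ℝ (Fin d)) :
    slVec A⁻¹ (slVec A v) = v := by
  rw [← slVec_mul, inv_mul_cancel, slVec_one]

theorem slVec_slVec_inv {d : ℕ} (A : SL d) (v : EuclideanSpace ℝ (Fin d)) :
    slVec A (slVec A⁻¹ v) = v := by
  rw [← slVec_mul, mul_inv_cancel, slVec_one]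

theorem slVec_smul {d : ℕ} (A : SL d) (c : ℝ) (v : EuclideanSpace ℝ (Fin d)) :
    slVec A (c • v) = c • slVec A v := by
  simp [slVec_eq]

theorem slVec_ne_zero {d : ℕ} (A : SL d) {v : EuclideanSpace ℝ (Fin d)} (hv : v ≠ 0) :
    slVec A v ≠ 0 := by
  intro h
  apply hv
  rw [← slVec_inv_slVec A v, h, slVec_eq, map_zero]

theorem norm_slVec_le {d : ℕ} (A : SL d) (v : EuclideanSpace ℝ (Fin d)) :
    ‖slVec A v‖ ≤ slNorm A * ‖v‖ :=
  (slCLM A).le_opNorm v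

theorem continuous_slCLM {d : ℕ} : Continuous (slCLM (d := d)) := by
  have h : Continuous (Matrix.toEuclideanCLM (n := Fin d) (𝕜 := ℝ)).toAlgEquiv.toLinearMap :=
    LinearMap.continuous_of_finiteDimensional _
  exact h.comp continuous_sl_coe

theorem continuous_slNorm {d : ℕ} : Continuous (slNorm (d := d)) :=
  continuous_slCLM.norm

theorem continuous_slVec {d : ℕ} :
    Continuous (fun p : SL d × EuclideanSpace ℝ (Fin d) => slVec p.1 p.2) :=
  (continuous_slCLM.comp continuous_fst).clm_apply continuous_snd

/-- The unit sphere of `ℝ^d`. -/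
abbrev Sph (d : ℕ) : Type := Metric.sphere (0 : EuclideanSpace ℝ (Fin d)) 1

theorem norm_sph {d : ℕ} (x : Sph d) : ‖(x : EuclideanSpace ℝ (Fin d))‖ = 1 := by
  simp

theorem sph_ne_zero {d : ℕ} (x : Sph d) : (x : EuclideanSpace ℝ (Fin d)) ≠ 0 := by
  intro h
  have := norm_sph x
  simp [h] at this

theorem norm_slVec_pos {d : ℕ} (A : SL d) (x : Sph d) :
    0 < ‖slVec A (x : EuclideanSpace ℝ (Fin d))‖ :=
  norm_pos_iff.2 (slVec_ne_zero A (sph_ne_zero x))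

/-- The action of `SL(d, ℝ)` on the unit sphere. -/
def sphAct {d : ℕ} (p : SL d × Sph d) : Sph d :=
  ⟨‖slVec p.1 (p.2 : EuclideanSpace ℝ (Fin d))‖⁻¹ • slVec p.1 (p.2 : EuclideanSpace ℝ (Fin d)), by
    rw [mem_sphere_zero_iff_norm, norm_smul, norm_inv, norm_norm]
    exact inv_mul_cancel₀ (norm_slVec_pos p.1 p.2).ne'⟩

theorem continuous_sphAct {d : ℕ} : Continuous (sphAct (d := d)) := by
  have h : Continuous (fun p : SL d × Sph d => slVec p.1 (p.2 : EuclideanSpace ℝ (Fin d))) := by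
    have := continuous_slVec (d := d)
    fun_prop
  have h' : Continuous (fun p : SL d × Sph d =>
      ‖slVec p.1 (p.2 : EuclideanSpace ℝ (Fin d))‖⁻¹ •
        slVec p.1 (p.2 : EuclideanSpace ℝ (Fin d))) :=
    (h.norm.inv₀ fun p => (norm_slVec_pos p.1 p.2).ne').smul h
  exact continuous_induced_rng.2 h'

theorem norm_smul_sphAct {d : ℕ} (A : SL d) (x : Sph d) :
    ‖slVec A (x : EuclideanSpace ℝ (Fin d))‖ • (sphAct (A, x) : EuclideanSpace ℝ (Fin d)) =
      slVec A (x : EuclideanSpace ℝ (Fin d)) := by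
  simp only [sphAct]
  rw [smul_smul, mul_inv_cancel₀ (norm_slVec_pos A x).ne', one_smul]

theorem norm_slVec_mul {d : ℕ} (A B : SL d) (x : Sph d) :
    ‖slVec (A * B) (x : EuclideanSpace ℝ (Fin d))‖ =
      ‖slVec A (sphAct (B, x) : EuclideanSpace ℝ (Fin d))‖ *
        ‖slVec B (x : EuclideanSpace ℝ (Fin d))‖ := by
  rw [slVec_mul, ← norm_smul_sphAct B x, slVec_smul, norm_smul, norm_norm, norm_smul, norm_norm,
    norm_sph, mul_one, mul_comm]

theorem sphAct_mul {d : ℕ} (A B : SL d) (x : Sph d) :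
    sphAct (A * B, x) = sphAct (A, sphAct (B, x)) := by
  apply Subtype.ext
  have hB := (norm_slVec_pos B x).ne'
  have hA := (norm_slVec_pos A (sphAct (B, x))).ne'
  have h : slVec (A * B) (x : EuclideanSpace ℝ (Fin d)) =
      ‖slVec B (x : EuclideanSpace ℝ (Fin d))‖ •
        slVec A (sphAct (B, x) : EuclideanSpace ℝ (Fin d)) := by
    rw [slVec_mul, ← slVec_smul, norm_smul_sphAct]
  change ‖slVec (A * B) (x : EuclideanSpace ℝ (Fin d))‖⁻¹ • slVec (A * B) _ =
    ‖slVec A (sphAct (B, x) : EuclideanSpace ℝ (Fin d))‖⁻¹ • slVec A _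
  rw [norm_slVec_mul, h, smul_smul, mul_inv, mul_assoc, inv_mul_cancel₀ hB, mul_one]

theorem sphAct_one {d : ℕ} (x : Sph d) : sphAct (1, x) = x := by
  apply Subtype.ext
  simp [sphAct, slVec_one]

/-- Passing to the unit vector does not change membership in a subspace. -/
theorem sphAct_mem_iff {d : ℕ} (W : Submodule ℝ (EuclideanSpace ℝ (Fin d))) (A : SL d)
    (x : Sph d) : (sphAct (A, x) : EuclideanSpace ℝ (Fin d)) ∈ W ↔
      (x : EuclideanSpace ℝ (Fin d)) ∈ W.comap (slCLM A).toLinearMap :=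
  W.smul_mem_iff (inv_ne_zero (norm_slVec_pos A x).ne')

/-! ### Sets of points reachable after many steps -/

/-- Points reachable in exactly `n` steps `y ↦ f (x, y)`, with `x ∈ K`. -/
def reachSet {X Y : Type*} (f : X × Y → Y) (K : Set X) : ℕ → Set Y
  | 0 => Set.univ
  | n + 1 => f '' (K ×ˢ reachSet f K n)

theorem reachSet_succ_subset {X Y : Type*} (f : X × Y → Y) (K : Set X) (n : ℕ) :
    reachSet f K (n + 1) ⊆ reachSet f K n := by
  induction n with
  | zero => exact Set.subset_univ _
  | succ n ih => exact Set.image_mono (Set.prod_mono le_rfl ih)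

theorem isCompact_reachSet {X Y : Type*} [TopologicalSpace X] [TopologicalSpace Y]
    [CompactSpace Y] {f : X × Y → Y} (hf : Continuous f) {K : Set X} (hK : IsCompact K) (n : ℕ) :
    IsCompact (reachSet f K n) := by
  induction n with
  | zero => exact isCompact_univ
  | succ n ih => exact (hK.prod ih).image hf

/-- A point reachable after arbitrarily many steps is the image of such a point. -/
theorem exists_preimage_mem_iInter_reachSet {X Y : Type*} [TopologicalSpace X] [T2Space X]
    [TopologicalSpace Y] [CompactSpace Y] [T2Space Y] {f : X × Y → Y} (hf : Continuous f)
    {K : Set X} (hK : IsCompact K) {y : Y} (hy : y ∈ ⋂ n, reachSet f K n) :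
    ∃ x ∈ K, ∃ y' ∈ ⋂ n, reachSet f K n, f (x, y') = y := by
  have key := IsCompact.nonempty_iInter_of_sequence_nonempty_isCompact_isClosed
    (fun n => (K ×ˢ reachSet f K n) ∩ f ⁻¹' {y})
    (fun n => Set.inter_subset_inter_left _ (Set.prod_mono le_rfl (reachSet_succ_subset f K n)))
    (fun n => by
      obtain ⟨p, hp, hpy⟩ := Set.mem_iInter.1 hy (n + 1)
      exact ⟨p, hp, hpy⟩)
    ((hK.prod (isCompact_reachSet hf hK 0)).inter_right (isClosed_singleton.preimage hf))
    (fun n => ((hK.prod (isCompact_reachSet hf hK n)).inter_right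
      (isClosed_singleton.preimage hf)).isClosed)
  obtain ⟨⟨x, y'⟩, hp⟩ := key
  rw [Set.mem_iInter] at hp
  exact ⟨x, (hp 0).1.1, y', Set.mem_iInter.2 fun n => (hp n).1.2, (hp 0).2⟩

/-! ### The mass of sections of closed sets -/

theorem upperSemicontinuous_measure_section {X Y : Type*}
    [TopologicalSpace X] [MeasurableSpace X] [BorelSpace X] [SecondCountableTopology X]
    [TopologicalSpace.PseudoMetrizableSpace X]
    [TopologicalSpace Y] [MeasurableSpace Y] [BorelSpace Y] [SecondCountableTopology Y]
    [TopologicalSpace.PseudoMetrizableSpace Y] {F : Set (X × Y)} (hF : IsClosed F) :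
    UpperSemicontinuous (fun p : ProbabilityMeasure X × Y =>
      (p.1 : Measure X) ((fun x => (x, p.2)) ⁻¹' F)) := by
  have hc : Continuous (fun p : ProbabilityMeasure X × Y => p.1.prod (diracProba p.2)) :=
    ProbabilityMeasure.continuous_prod.comp
      (continuous_fst.prodMk (continuous_diracProba.comp continuous_snd))
  have hval (p : ProbabilityMeasure X × Y) :
      (p.1 : Measure X) ((fun x => (x, p.2)) ⁻¹' F) =
        (p.1.prod (diracProba p.2) : ProbabilityMeasure (X × Y)).toMeasure F := by
    rw [ProbabilityMeasure.toMeasure_prod]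
    change _ = ((p.1 : Measure X).prod (Measure.dirac p.2)) F
    rw [Measure.prod_dirac, Measure.map_apply (by fun_prop) hF.measurableSet]
  intro p
  refine upperSemicontinuousAt_iff_limsup_le.2 ?_
  simp only [hval]
  exact ProbabilityMeasure.limsup_measure_closed_le_of_tendsto (hc.tendsto p) hF

/-! ### Random steps on the sphere -/

/-- The law of `A • x` for independent `A ∼ μ`, `x ∼ ν`. -/
def sphStep {d : ℕ} (p : ProbabilityMeasure (SL d) × ProbabilityMeasure (Sph d)) :
    ProbabilityMeasure (Sph d) :=
  (p.1.prod p.2).map continuous_sphAct.measurable.aemeasurable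

theorem continuous_sphStep {d : ℕ} : Continuous (sphStep (d := d)) :=
  (ProbabilityMeasure.continuous_map continuous_sphAct).comp ProbabilityMeasure.continuous_prod

/-- The mass that a measure on the sphere gives to a linear subspace. -/
def subMass {d : ℕ} (ν : ProbabilityMeasure (Sph d))
    (W : Submodule ℝ (EuclideanSpace ℝ (Fin d))) : ℝ≥0∞ :=
  (ν : Measure (Sph d)) {x | (x : EuclideanSpace ℝ (Fin d)) ∈ W}

theorem measurableSet_sph_mem {d : ℕ} (W : Submodule ℝ (EuclideanSpace ℝ (Fin d))) :
    MeasurableSet {x : Sph d | (x : EuclideanSpace ℝ (Fin d)) ∈ W} :=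
  (W.closed_of_finiteDimensional.preimage continuous_subtype_val).measurableSet

theorem subMass_sphStep {d : ℕ} (μ : ProbabilityMeasure (SL d)) (ν : ProbabilityMeasure (Sph d))
    (W : Submodule ℝ (EuclideanSpace ℝ (Fin d))) :
    subMass (sphStep (μ, ν)) W =
      ∫⁻ A, subMass ν (W.comap (slCLM A).toLinearMap) ∂(μ : Measure (SL d)) := by
  have h1 : subMass (sphStep (μ, ν)) W =
      (((μ : Measure (SL d)).prod (ν : Measure (Sph d))).map sphAct)
        {x | (x : EuclideanSpace ℝ (Fin d)) ∈ W} := rfl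
  rw [h1, Measure.map_apply continuous_sphAct.measurable (measurableSet_sph_mem W),
    Measure.prod_apply (continuous_sphAct.measurable (measurableSet_sph_mem W))]
  refine lintegral_congr fun A => ?_
  simp only [subMass]
  congr 1
  ext x
  exact sphAct_mem_iff W A x

theorem slLin_injective {d : ℕ} (A : SL d) : Function.Injective (slCLM A).toLinearMap :=
  Function.LeftInverse.injective (slVec_inv_slVec A)

theorem slLin_surjective {d : ℕ} (A : SL d) : Function.Surjective (slCLM A).toLinearMap :=
  Function.RightInverse.surjective (slVec_slVec_inv A)

theorem finrank_comap_slCLM {d : ℕ} (A : SL d) (W : Submodule ℝ (EuclideanSpace ℝ (Fin d))) :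
    Module.finrank ℝ (W.comap (slCLM A).toLinearMap) = Module.finrank ℝ W := by
  rw [(Submodule.equivMapOfInjective _ (slLin_injective A)
    (W.comap (slCLM A).toLinearMap)).finrank_eq,
    Submodule.map_comap_eq_of_surjective (slLin_surjective A)]

theorem subMass_bot {d : ℕ} (ν : ProbabilityMeasure (Sph d)) : subMass ν ⊥ = 0 := by
  simp only [subMass, Submodule.mem_bot]
  have h : {x : Sph d | (x : EuclideanSpace ℝ (Fin d)) = 0} = ∅ :=
    Set.eq_empty_of_forall_notMem fun x => sph_ne_zero x
  rw [h, measure_empty]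

theorem isCompact_setOf_orthonormal {E : Type*} [NormedAddCommGroup E] [InnerProductSpace ℝ E]
    [ProperSpace E] (k : ℕ) : IsCompact {u : Fin k → E | Orthonormal ℝ u} := by
  refine (isCompact_closedBall (0 : Fin k → E) 1).of_isClosed_subset ?_ ?_
  · simp only [orthonormal_iff_ite]
    simp only [Set.ofPred_forall]
    refine isClosed_iInter fun i => isClosed_iInter fun j => isClosed_eq ?_ continuous_const
    fun_prop
  · intro u hu
    rw [mem_closedBall_zero_iff, pi_norm_le_iff_of_nonneg zero_le_one]
    exact fun i => (hu.1 i).le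

theorem mem_orthogonal_span_range_iff {E ι : Type*} [NormedAddCommGroup E]
    [InnerProductSpace ℝ E] (u : ι → E) (x : E) :
    x ∈ (Submodule.span ℝ (Set.range u))ᗮ ↔ ∀ i, inner ℝ (u i) x = 0 := by
  rw [Submodule.mem_orthogonal]
  refine ⟨fun h i => h _ (Submodule.subset_span ⟨i, rfl⟩), fun h y hy => ?_⟩
  induction hy using Submodule.span_induction with
  | mem y hy => obtain ⟨i, rfl⟩ := hy; exact h i
  | zero => simp
  | add y z _ _ hy hz => rw [inner_add_left, hy, hz, add_zero]
  | smul c y _ hy => rw [inner_smul_left, hy, mul_zero]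

theorem exists_orthonormal_eq_orthogonal {E : Type*} [NormedAddCommGroup E]
    [InnerProductSpace ℝ E] [FiniteDimensional ℝ E] {k : ℕ} (W : Submodule ℝ E)
    (hW : Module.finrank ℝ W + k = Module.finrank ℝ E) :
    ∃ u : Fin k → E, Orthonormal ℝ u ∧ W = (Submodule.span ℝ (Set.range u))ᗮ := by
  have hk : Module.finrank ℝ Wᗮ = k := by
    have := W.finrank_add_finrank_orthogonal
    omega
  let b := (stdOrthonormalBasis ℝ Wᗮ).reindex (finCongr hk)
  refine ⟨fun i => (b i : E), ?_, ?_⟩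
  · exact b.orthonormal.comp_linearIsometry Wᗮ.subtypeₗᵢ
  · have h : Submodule.span ℝ (Set.range fun i => (b i : E)) = Wᗮ := by
      have h1 : (Set.range fun i => (b i : E)) = Wᗮ.subtype '' Set.range b := by
        rw [← Set.range_comp]; rfl
      rw [h1, Submodule.span_image, ← b.coe_toBasis, b.toBasis.span_eq, Submodule.map_top,
        Submodule.range_subtype]
    rw [h, Submodule.orthogonal_orthogonal]

theorem finrank_orthogonal_span_orthonormal {E : Type*} [NormedAddCommGroup E]
    [InnerProductSpace ℝ E] [FiniteDimensional ℝ E] {k : ℕ} {u : Fin k → E}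
    (hu : Orthonormal ℝ u) :
    Module.finrank ℝ (Submodule.span ℝ (Set.range u))ᗮ + k = Module.finrank ℝ E := by
  have h := (Submodule.span ℝ (Set.range u)).finrank_add_finrank_orthogonal
  rw [finrank_span_eq_card hu.linearIndependent, Fintype.card_fin] at h
  omega

/-- Over a compact set of measures, the mass of `j`-dimensional subspaces attains its maximum. -/
theorem exists_max_subMass {d : ℕ} {R : Set (ProbabilityMeasure (Sph d))} (hR : IsCompact R)
    (hne : R.Nonempty) {j : ℕ} (hj : j ≤ d) :
    ∃ ν ∈ R, ∃ W : Submodule ℝ (EuclideanSpace ℝ (Fin d)), Module.finrank ℝ W = j ∧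
      ∀ ν' ∈ R, ∀ W' : Submodule ℝ (EuclideanSpace ℝ (Fin d)), Module.finrank ℝ W' = j →
        subMass ν' W' ≤ subMass ν W := by
  obtain ⟨k, rfl⟩ := Nat.exists_eq_add_of_le hj
  set E := EuclideanSpace ℝ (Fin (j + k))
  have hdim : Module.finrank ℝ E = j + k := finrank_euclideanSpace_fin
  have hF : IsClosed {p : Sph (j + k) × (Fin k → E) | ∀ i, inner ℝ (p.2 i) (p.1 : E) = 0} := by
    simp only [Set.ofPred_forall]
    refine isClosed_iInter fun i => isClosed_eq ?_ continuous_const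
    fun_prop
  have husc := upperSemicontinuous_measure_section hF
  have hO : {u : Fin k → E | Orthonormal ℝ u}.Nonempty := by
    obtain ⟨u, hu, -⟩ := exists_orthonormal_eq_orthogonal (k := k)
      (Submodule.span ℝ (Set.range fun i : Fin j =>
        (EuclideanSpace.basisFun (Fin (j + k)) ℝ (Fin.castAdd k i) : E))) (by
      rw [finrank_span_eq_card, Fintype.card_fin, hdim]
      exact ((EuclideanSpace.basisFun (Fin (j + k)) ℝ).orthonormal.comp _
        (Fin.castAdd_injective j k)).linearIndependent)
    exact ⟨u, hu⟩
  have hval (ν : ProbabilityMeasure (Sph (j + k))) (u : Fin k → E) :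
      subMass ν (Submodule.span ℝ (Set.range u))ᗮ = (ν : Measure (Sph (j + k)))
        ((fun x => (x, u)) ⁻¹' {p : Sph (j + k) × (Fin k → E) |
          ∀ i, inner ℝ (p.2 i) (p.1 : E) = 0}) := by
    simp only [subMass, mem_orthogonal_span_range_iff]
    rfl
  obtain ⟨⟨ν, u⟩, ⟨hν, hu⟩, hmax⟩ := (husc.upperSemicontinuousOn _).exists_isMaxOn
    (hne.prod hO) (hR.prod (isCompact_setOf_orthonormal k))
  refine ⟨ν, hν, (Submodule.span ℝ (Set.range u))ᗮ, ?_, fun ν' hν' W' hW' => ?_⟩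
  · exact Nat.add_right_cancel
      ((finrank_orthogonal_span_orthonormal (E := E) (show Orthonormal ℝ u from hu)).trans hdim)
  · obtain ⟨u', hu', rfl⟩ := exists_orthonormal_eq_orthogonal (k := k) W' (by rw [hW', hdim])
    rw [hval, hval]
    exact hmax (show (ν', u') ∈ R ×ˢ _ from ⟨hν', hu'⟩)

/-- If subspaces of lower dimension have mass zero, only boundedly many `j`-dimensional subspaces
have mass `M`. -/
theorem card_mul_le_one_of_subMass_eq {d j : ℕ} {ν : ProbabilityMeasure (Sph d)} {M : ℝ≥0∞}
    (hlow : ∀ W : Submodule ℝ (EuclideanSpace ℝ (Fin d)), Module.finrank ℝ W < j →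
      subMass ν W = 0)
    (s : Finset (Submodule ℝ (EuclideanSpace ℝ (Fin d))))
    (hs : ∀ W ∈ s, Module.finrank ℝ W = j ∧ subMass ν W = M) : (s.card : ℝ≥0∞) * M ≤ 1 := by
  have h := measure_biUnion_finset₀ (μ := (ν : Measure (Sph d))) (s := s)
    (f := fun W => {x : Sph d | (x : EuclideanSpace ℝ (Fin d)) ∈ W}) ?_
    (fun W _ => (measurableSet_sph_mem W).nullMeasurableSet)
  · have h1 : ∑ W ∈ s, (ν : Measure (Sph d)) {x | (x : EuclideanSpace ℝ (Fin d)) ∈ W} =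
        s.card * M :=
      (Finset.sum_congr rfl fun W hW => (hs W hW).2).trans (by rw [Finset.sum_const, nsmul_eq_mul])
    rw [← h1, ← h]
    exact prob_le_one
  · intro W hW W' hW' hne
    have h0 : subMass ν (W ⊓ W') = 0 := by
      apply hlow
      rw [← (hs W hW).1]
      refine Submodule.finrank_lt_finrank_of_lt (lt_of_le_of_ne inf_le_left fun h => hne ?_)
      exact Submodule.eq_of_le_of_finrank_eq (inf_eq_left.1 h)
        ((hs W hW).1.trans (hs W' hW').1.symm)
    exact h0

theorem isFiniteUnionOfProperSubspaces_image {d : ℕ}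
    {S : Set (Submodule ℝ (EuclideanSpace ℝ (Fin d)))} (hfin : S.Finite) (hne : S.Nonempty)
    (hprop : ∀ W ∈ S, W ≠ ⊥ ∧ W ≠ ⊤) :
    IsFiniteUnionOfProperSubspaces
      (WithLp.linearEquiv 2 ℝ (Fin d → ℝ) '' ⋃ W ∈ S, (W : Set (EuclideanSpace ℝ (Fin d)))) := by
  set e := WithLp.linearEquiv 2 ℝ (Fin d → ℝ)
  refine ⟨(fun W => W.map e.toLinearMap) '' S, hfin.image _, hne.image _, ?_, ?_⟩
  · rintro _ ⟨W, hW, rfl⟩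
    refine ⟨fun h => (hprop W hW).1 ?_, fun h => (hprop W hW).2 ?_⟩
    · exact Submodule.map_injective_of_injective e.injective
        (h.trans (Submodule.map_bot e.toLinearMap).symm)
    · have h2 : W.map e.toLinearMap = (⊤ : Submodule ℝ _).map e.toLinearMap :=
        Eq.trans h (by rw [Submodule.map_top]; exact (LinearEquiv.range e).symm)
      exact Submodule.map_injective_of_injective e.injective h2
  · rw [Set.biUnion_image, Set.image_iUnion₂]
    rfl

/-- Under the spaces condition, random preimages do not a.s. carry one finite family of proper
subspaces onto another. -/
theorem SpacesCondition.not_ae_comap_image_eq {d : ℕ} {μ : ProbabilityMeasure (SL d)}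
    (h : SpacesCondition μ) {S S' : Set (Submodule ℝ (EuclideanSpace ℝ (Fin d)))}
    (hfin : S.Finite) (hne : S.Nonempty) (hprop : ∀ W ∈ S, W ≠ ⊥ ∧ W ≠ ⊤)
    (hfin' : S'.Finite) (hne' : S'.Nonempty) (hprop' : ∀ W ∈ S', W ≠ ⊥ ∧ W ≠ ⊤) :
    ¬ ∀ᵐ A ∂(μ : Measure (SL d)),
      (fun W : Submodule ℝ (EuclideanSpace ℝ (Fin d)) => W.comap (slCLM A).toLinearMap) '' S =
        S' := by
  intro hae
  refine h ⟨_, _, isFiniteUnionOfProperSubspaces_image hfin' hne' hprop',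
    isFiniteUnionOfProperSubspaces_image hfin hne hprop, ?_⟩
  filter_upwards [hae] with A hA
  subst hA
  rw [Set.biUnion_image, Set.image_image]
  have h1 (v : EuclideanSpace ℝ (Fin d)) :
      Matrix.toLin' (A : Matrix (Fin d) (Fin d) ℝ) (WithLp.linearEquiv 2 ℝ (Fin d → ℝ) v) =
        WithLp.linearEquiv 2 ℝ (Fin d → ℝ) ((slCLM A).toLinearMap v) := by
    simp [slCLM]
  simp only [h1]
  rw [← Set.image_image (WithLp.linearEquiv 2 ℝ (Fin d → ℝ)) (slCLM A).toLinearMap]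
  congr 1
  rw [Set.image_iUnion₂]
  refine Set.iUnion₂_congr fun W _ => ?_
  exact Set.image_preimage_eq _ (slLin_surjective A)

/-- Measures that are reachable after arbitrarily many steps do not charge proper subspaces. -/
theorem subMass_eq_zero_of_mem_iInter_reachSet {d : ℕ} {K : Set (ProbabilityMeasure (SL d))}
    (hK : IsCompact K) (hsp : ∀ μ ∈ K, SpacesCondition μ) {ν : ProbabilityMeasure (Sph d)}
    (hν : ν ∈ ⋂ n, reachSet sphStep K n) {W : Submodule ℝ (EuclideanSpace ℝ (Fin d))}
    (hW : W ≠ ⊤) : subMass ν W = 0 := by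
  classical
  by_contra hpos
  set R : Set (ProbabilityMeasure (Sph d)) := ⋂ n, reachSet sphStep K n
  have hRc : IsCompact R := (isClosed_iInter fun n =>
    (isCompact_reachSet continuous_sphStep hK n).isClosed).isCompact
  have hex : ∃ j, ∃ ν ∈ R, ∃ W : Submodule ℝ (EuclideanSpace ℝ (Fin d)),
      Module.finrank ℝ W = j ∧ subMass ν W ≠ 0 := ⟨_, ν, hν, W, rfl, hpos⟩
  set j := Nat.find hex with hj
  have hlow : ∀ ν ∈ R, ∀ W : Submodule ℝ (EuclideanSpace ℝ (Fin d)), Module.finrank ℝ W < j →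
      subMass ν W = 0 := by
    intro ν hν W hWj
    by_contra hne
    exact Nat.find_min hex hWj ⟨ν, hν, W, rfl, hne⟩
  have hjd : j < d := by
    have h1 : j ≤ Module.finrank ℝ W := Nat.find_min' hex ⟨ν, hν, W, rfl, hpos⟩
    have h2 := Submodule.finrank_lt hW
    rw [finrank_euclideanSpace_fin] at h2
    omega
  obtain ⟨ν₀, hν₀, W₀, hW₀, hmax⟩ := exists_max_subMass hRc ⟨ν, hν⟩ hjd.le
  set M := subMass ν₀ W₀
  have hM0 : M ≠ 0 := by
    obtain ⟨ν₁, hν₁, W₁, hW₁, hne⟩ := Nat.find_spec hex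
    exact fun h => hne (le_zero_iff.1 (h ▸ hmax ν₁ hν₁ W₁ hW₁))
  have hj0 : 0 < j := by
    by_contra h0
    have h0' : Module.finrank ℝ W₀ = 0 := by omega
    rw [Submodule.finrank_eq_zero] at h0'
    exact hM0 (by simp only [M, h0', subMass_bot])
  have hMtop : M ≠ ∞ := measure_ne_top _ _
  let S : ProbabilityMeasure (Sph d) → Set (Submodule ℝ (EuclideanSpace ℝ (Fin d))) :=
    fun ν => {W | Module.finrank ℝ W = j ∧ subMass ν W = M}
  obtain ⟨N, hN⟩ := ENNReal.exists_nat_mul_gt hM0 (b := 1) ENNReal.one_ne_top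
  have hcard : ∀ ν ∈ R, ∀ s : Finset (Submodule ℝ (EuclideanSpace ℝ (Fin d))), ↑s ⊆ S ν →
      s.card ≤ N := by
    intro ν hν s hs
    by_contra! hlt
    have h1 := card_mul_le_one_of_subMass_eq (hlow ν hν) s (fun W hW => hs hW)
    refine absurd (hN.trans_le ?_) (not_lt.2 h1)
    gcongr
  have hfin : ∀ ν ∈ R, (S ν).Finite := by
    intro ν hν
    by_contra hinf
    obtain ⟨s, hs, hc⟩ := Set.Infinite.exists_subset_card_eq hinf (N + 1)
    have := hcard ν hν s hs
    omega
  have hncard : ∀ ν ∈ R, (S ν).ncard ≤ N := by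
    intro ν hν
    rw [Set.ncard_eq_toFinset_card _ (hfin ν hν)]
    exact hcard ν hν _ (by simp)
  have hbdd : BddAbove ((fun ν => (S ν).ncard) '' R) := ⟨N, by
    rintro _ ⟨ν, hν, rfl⟩
    exact hncard ν hν⟩
  obtain ⟨ν₁, hν₁, hν₁max⟩ := Nat.sSup_mem (Set.Nonempty.image _ ⟨ν₀, hν₀⟩) hbdd
  have hle : ∀ ν ∈ R, (S ν).ncard ≤ (S ν₁).ncard := fun ν hν =>
    (le_csSup hbdd ⟨ν, hν, rfl⟩).trans_eq hν₁max.symm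
  have hne₁ : (S ν₁).Nonempty := by
    rw [← Set.ncard_pos (hfin ν₁ hν₁)]
    refine lt_of_lt_of_le ?_ (hle ν₀ hν₀)
    rw [Set.ncard_pos (hfin ν₀ hν₀)]
    exact ⟨W₀, hW₀, rfl⟩
  obtain ⟨μ, hμ, ν₂, hν₂, hstep⟩ := exists_preimage_mem_iInter_reachSet continuous_sphStep hK hν₁
  have hsub : ∀ᵐ A ∂(μ : Measure (SL d)), ∀ W ∈ S ν₁,
      W.comap (slCLM A).toLinearMap ∈ S ν₂ := by
    rw [ae_ball_iff (hfin ν₁ hν₁).countable]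
    intro W hW
    have hbound : ∀ A : SL d, subMass ν₂ (W.comap (slCLM A).toLinearMap) ≤ M := fun A =>
      hmax ν₂ hν₂ _ ((finrank_comap_slCLM A W).trans hW.1)
    have hint : ∫⁻ _, M ∂(μ : Measure (SL d)) ≤
        ∫⁻ A, subMass ν₂ (W.comap (slCLM A).toLinearMap) ∂(μ : Measure (SL d)) := by
      rw [← subMass_sphStep, hstep, hW.2, lintegral_const, measure_univ, mul_one]
    have hae := ae_eq_of_ae_le_of_lintegral_le (ae_of_all _ hbound)
      (by
        refine ne_top_of_le_ne_top ?_ (lintegral_mono hbound)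
        simpa using hMtop)
      aemeasurable_const hint
    filter_upwards [hae] with A hA
    exact ⟨(finrank_comap_slCLM A W).trans hW.1, hA⟩
  have himage : ∀ᵐ A ∂(μ : Measure (SL d)),
      (fun W : Submodule ℝ (EuclideanSpace ℝ (Fin d)) => W.comap (slCLM A).toLinearMap) '' S ν₁ =
        S ν₂ := by
    filter_upwards [hsub] with A hA
    refine Set.eq_of_subset_of_ncard_le (Set.image_subset_iff.2 hA) ?_ (hfin ν₂ hν₂)
    rw [Set.ncard_image_of_injective _
      (Submodule.comap_injective_of_surjective (slLin_surjective A))]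
    exact hle ν₂ hν₂
  have hprop : ∀ ν, ∀ W ∈ S ν, W ≠ ⊥ ∧ W ≠ ⊤ := by
    intro ν W hW
    constructor
    · rintro rfl
      have := hW.1
      rw [finrank_bot] at this
      omega
    · rintro rfl
      have := hW.1
      rw [finrank_top, finrank_euclideanSpace_fin] at this
      omega
  have hne₂ : (S ν₂).Nonempty := by
    obtain ⟨A, hA⟩ := hsub.exists
    obtain ⟨W, hW⟩ := hne₁
    exact ⟨_, hA W hW⟩
  exact (hsp μ hμ).not_ae_comap_image_eq (hfin ν₁ hν₁) hne₁ (hprop ν₁) (hfin ν₂ hν₂) hne₂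
    (hprop ν₂) himage

/-- After sufficiently many steps, neighbourhoods of hyperplanes have uniformly small mass. -/
theorem exists_reachSet_mass_hyperplane_le {d : ℕ} {K : Set (ProbabilityMeasure (SL d))}
    (hK : IsCompact K) (hsp : ∀ μ ∈ K, SpacesCondition μ) {ε : ℝ≥0∞} (hε : 0 < ε) :
    ∃ n : ℕ, ∃ κ : ℝ, 0 < κ ∧ κ ≤ 1 ∧ ∀ ν ∈ reachSet sphStep K n, ∀ u : Sph d,
      (ν : Measure (Sph d)) {x | |inner ℝ (u : EuclideanSpace ℝ (Fin d)) x| ≤ κ} ≤ ε := by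
  by_contra! hcon
  have hF (κ : ℝ) : IsClosed {p : Sph d × Sph d |
      |inner ℝ (p.2 : EuclideanSpace ℝ (Fin d)) p.1| ≤ κ} :=
    isClosed_le (by fun_prop) continuous_const
  let κ : ℕ → ℝ := fun n => 1 / (n + 1)
  have hκpos (n : ℕ) : 0 < κ n := Nat.one_div_pos_of_nat
  have hκanti : Antitone κ := fun m n h => Nat.one_div_le_one_div h
  let G : ℕ → Set (ProbabilityMeasure (Sph d) × Sph d) := fun n =>
    (reachSet sphStep K n ×ˢ Set.univ) ∩ {p | ε ≤ (p.1 : Measure (Sph d))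
      {x | |inner ℝ (p.2 : EuclideanSpace ℝ (Fin d)) x| ≤ κ n}}
  have hGclosed (n : ℕ) : IsClosed (G n) :=
    ((isCompact_reachSet continuous_sphStep hK n).isClosed.prod isClosed_univ).inter
      ((upperSemicontinuous_measure_section (hF (κ n))).isClosed_preimage ε)
  obtain ⟨⟨ν, u⟩, hp⟩ := IsCompact.nonempty_iInter_of_sequence_nonempty_isCompact_isClosed G
    (fun n => Set.inter_subset_inter
      (Set.prod_mono (reachSet_succ_subset _ K n) le_rfl)
      (fun p hp => le_trans hp (measure_mono fun x hx => le_trans hx (hκanti n.le_succ))))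
    (fun n => by
      obtain ⟨ν, hν, u, hu⟩ := hcon n (κ n) (hκpos n)
        (by simpa [κ] using hκanti n.zero_le)
      exact ⟨(ν, u), ⟨hν, trivial⟩, hu.le⟩)
    (hGclosed 0).isCompact hGclosed
  rw [Set.mem_iInter] at hp
  have hzero : subMass ν (ℝ ∙ (u : EuclideanSpace ℝ (Fin d)))ᗮ = 0 := by
    refine subMass_eq_zero_of_mem_iInter_reachSet hK hsp (Set.mem_iInter.2 fun n => (hp n).1.1) ?_
    intro htop
    rw [Submodule.orthogonal_eq_top_iff, Submodule.span_singleton_eq_bot] at htop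
    exact sph_ne_zero u htop
  have hlim := tendsto_measure_iInter_atTop (μ := (ν : Measure (Sph d)))
    (s := fun n => {x : Sph d | |inner ℝ (u : EuclideanSpace ℝ (Fin d)) x| ≤ κ n})
    (fun n => (isClosed_le (by fun_prop) continuous_const).measurableSet.nullMeasurableSet)
    (fun m n h x hx => le_trans hx (hκanti h)) ⟨0, measure_ne_top _ _⟩
  have hle := ge_of_tendsto' hlim fun n => (hp n).2
  refine absurd (hle.trans ((measure_mono ?_).trans_eq hzero)) (not_le.2 hε)
  intro x hx
  rw [Set.mem_iInter] at hx
  have h0 : |inner ℝ (u : EuclideanSpace ℝ (Fin d)) x| ≤ 0 :=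
    ge_of_tendsto' tendsto_one_div_add_atTop_nhds_zero_nat hx
  exact Submodule.mem_orthogonal_singleton_iff_inner_right.2 (abs_nonpos_iff.1 h0)

/-! ### Laws of the random products -/

/-- The law of `Tₙ`. -/
def law {d : ℕ} (μ : ℕ → ProbabilityMeasure (SL d)) : ℕ → Measure (SL d)
  | 0 => Measure.dirac 1
  | n + 1 => Measure.mconv (μ n : Measure (SL d)) (law μ n)

instance {d : ℕ} (μ : ℕ → ProbabilityMeasure (SL d)) (n : ℕ) : IsProbabilityMeasure (law μ n) := by
  induction n with
  | zero => exact inferInstanceAs (IsProbabilityMeasure (Measure.dirac _))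
  | succ n ih => exact inferInstanceAs (IsProbabilityMeasure (Measure.mconv _ _))

theorem law_add {d : ℕ} (μ : ℕ → ProbabilityMeasure (SL d)) (m n : ℕ) :
    law μ (m + n) = Measure.mconv (law (fun i => μ (i + n)) m) (law μ n) := by
  induction m with
  | zero => rw [Nat.zero_add]; exact (Measure.dirac_one_mconv _).symm
  | succ m ih =>
    rw [Nat.add_right_comm]
    change Measure.mconv _ (law μ (m + n)) = Measure.mconv (Measure.mconv _ _) _
    rw [ih, Measure.mconv_assoc]

theorem lintegral_law_add {d : ℕ} (μ : ℕ → ProbabilityMeasure (SL d)) (m n : ℕ)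
    {f : SL d → ℝ≥0∞} (hf : Measurable f) :
    ∫⁻ A, f A ∂law μ (m + n) =
      ∫⁻ B, ∫⁻ A, f (B * A) ∂law μ n ∂law (fun i => μ (i + n)) m := by
  rw [law_add, Measure.lintegral_mconv hf]

theorem lintegral_law_add_symm {d : ℕ} (μ : ℕ → ProbabilityMeasure (SL d)) (m n : ℕ)
    {f : SL d → ℝ≥0∞} (hf : Measurable f) :
    ∫⁻ A, f A ∂law μ (m + n) =
      ∫⁻ A, ∫⁻ B, f (B * A) ∂law (fun i => μ (i + n)) m ∂law μ n := by
  rw [lintegral_law_add μ m n hf, lintegral_lintegral_swap]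
  exact (hf.comp measurable_mul).aemeasurable

/-- The product of a finite tuple, in reversed order. -/
def tupleProd {d : ℕ} : (n : ℕ) → (Fin n → SL d) → SL d
  | 0, _ => 1
  | n + 1, a => a (Fin.last n) * tupleProd n (fun i => a i.castSucc)

theorem T_eq_tupleProd {d : ℕ} (ω : ℕ → SL d) (n : ℕ) :
    T ω n = tupleProd n (fun i => ω i) := by
  induction n with
  | zero => rfl
  | succ n ih => simp only [T, tupleProd, ih]; rfl

theorem measurable_tupleProd {d : ℕ} (n : ℕ) : Measurable (tupleProd (d := d) n) := by
  induction n with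
  | zero => exact measurable_const
  | succ n ih =>
    refine (measurable_pi_apply _).mul (ih.comp ?_)
    exact measurable_pi_lambda _ fun i => measurable_pi_apply _

theorem map_tupleProd_pi {d : ℕ} (μ : ℕ → ProbabilityMeasure (SL d)) (n : ℕ) :
    (Measure.pi (fun i : Fin n => (μ i : Measure (SL d)))).map (tupleProd n) = law μ n := by
  induction n with
  | zero =>
    rw [show tupleProd (d := d) 0 = fun _ => 1 from rfl, Measure.map_const]
    simp [law]
  | succ n ih =>
    have hmp := measurePreserving_piFinSuccAbove
      (fun i : Fin (n + 1) => (μ i : Measure (SL d))) (Fin.last n)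
    have hcomp : tupleProd (d := d) (n + 1) =
        (fun p : SL d × SL d => p.1 * p.2) ∘ (Prod.map id (tupleProd n)) ∘
          (MeasurableEquiv.piFinSuccAbove (fun _ : Fin (n + 1) => SL d) (Fin.last n)) := by
      funext a
      simp [tupleProd, MeasurableEquiv.piFinSuccAbove, Fin.insertNthEquiv]
      rfl
    have hm : Measurable (Prod.map (id : SL d → SL d) (tupleProd (d := d) n)) :=
      measurable_id.prodMap (measurable_tupleProd n)
    rw [hcomp, ← Measure.map_map measurable_mul (hm.comp (MeasurableEquiv.measurable _)),
      ← Measure.map_map hm (MeasurableEquiv.measurable _), hmp.map_eq]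
    simp only [Fin.succAbove_last, Fin.val_last, Fin.val_castSucc]
    rw [← Measure.map_prod_map _ _ measurable_id (measurable_tupleProd n), ih, Measure.map_id]
    rfl

theorem measurable_T {d : ℕ} (n : ℕ) : Measurable (fun ω : ℕ → SL d => T ω n) := by
  simp only [T_eq_tupleProd]
  exact (measurable_tupleProd n).comp (measurable_pi_lambda _ fun i => measurable_pi_apply _)

theorem IsProductMeasure.map_T {d : ℕ} {μ : ℕ → ProbabilityMeasure (SL d)}
    {ℙ : Measure (ℕ → SL d)} (h : IsProductMeasure μ ℙ) (n : ℕ) :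
    ℙ.map (fun ω => T ω n) = law μ n := by
  simp only [T_eq_tupleProd]
  have hm : Measurable (fun (ω : ℕ → SL d) (i : Fin n) => ω i) :=
    measurable_pi_lambda _ fun i => measurable_pi_apply _
  rw [← map_tupleProd_pi, ← h.2 n, Measure.map_map (measurable_tupleProd n) hm]
  rfl

/-- The law of the direction of `Tₙ v`. -/
theorem exists_mem_reachSet_eq_map {d : ℕ} {K : Set (ProbabilityMeasure (SL d))}
    {μ : ℕ → ProbabilityMeasure (SL d)} (hμ : ∀ i, μ i ∈ K) (v : Sph d) (n : ℕ) :
    ∃ ν ∈ reachSet sphStep K n,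
      (ν : Measure (Sph d)) = (law μ n).map (fun A => sphAct (A, v)) := by
  have hm : Measurable (fun A : SL d => sphAct (A, v)) := by
    have := continuous_sphAct (d := d)
    exact Continuous.measurable (by fun_prop)
  induction n with
  | zero =>
    refine ⟨⟨Measure.dirac v, inferInstance⟩, Set.mem_univ _, ?_⟩
    change Measure.dirac v = (Measure.dirac 1).map _
    rw [Measure.map_dirac' hm, sphAct_one]
  | succ n ih =>
    obtain ⟨ν, hν, hνeq⟩ := ih
    refine ⟨sphStep (μ n, ν), ⟨(μ n, ν), ⟨hμ n, hν⟩, rfl⟩, ?_⟩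
    change ((μ n : Measure (SL d)).prod (ν : Measure (Sph d))).map sphAct =
      (Measure.map (fun x : SL d × SL d => x.1 * x.2) _).map _
    have h1 := Measure.map_prod_map (μ n : Measure (SL d)) (law μ n) measurable_id hm
    rw [Measure.map_id] at h1
    rw [hνeq, h1, Measure.map_map continuous_sphAct.measurable (measurable_id.prodMap hm),
      Measure.map_map hm measurable_mul]
    congr 1
    funext p
    exact (sphAct_mul p.1 p.2 v).symm

/-! ### Size of a matrix and exponential moments -/

/-- The standard basis vectors as points of the sphere. -/
def basisSph {d : ℕ} (i : Fin d) : Sph d := ⟨EuclideanSpace.single i 1, by simp⟩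

theorem basisSph_coe {d : ℕ} (i : Fin d) :
    (basisSph i : EuclideanSpace ℝ (Fin d)) = EuclideanSpace.basisFun (Fin d) ℝ i := by
  simp [basisSph]

theorem norm_slVec_sph_le {d : ℕ} (A : SL d) (x : Sph d) :
    ‖slVec A (x : EuclideanSpace ℝ (Fin d))‖ ≤ slNorm A := by
  simpa [norm_sph] using norm_slVec_le A (x : EuclideanSpace ℝ (Fin d))

theorem slNorm_pos {d : ℕ} [NeZero d] (A : SL d) : 0 < slNorm A :=
  (norm_slVec_pos A (basisSph 0)).trans_le (norm_slVec_sph_le A _)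

theorem slNorm_mul_le {d : ℕ} (A B : SL d) : slNorm (A * B) ≤ slNorm A * slNorm B := by
  rw [slNorm_eq, slCLM_mul]
  exact norm_mul_le _ _

theorem slNorm_one {d : ℕ} [NeZero d] : slNorm (1 : SL d) = 1 := by
  have : Nontrivial (EuclideanSpace ℝ (Fin d)) := ⟨_, _, sph_ne_zero (basisSph (0 : Fin d))⟩
  rw [slNorm_eq, slCLM_one, norm_one]

theorem one_le_slNorm_inv_mul {d : ℕ} (A : SL d) (x : Sph d) :
    1 ≤ slNorm A⁻¹ * ‖slVec A (x : EuclideanSpace ℝ (Fin d))‖ := by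
  have := norm_slVec_le A⁻¹ (slVec A (x : EuclideanSpace ℝ (Fin d)))
  rwa [slVec_inv_slVec, norm_sph] at this

theorem slNorm_le_sum {d : ℕ} (A : SL d) :
    slNorm A ≤ ∑ i : Fin d, ‖slVec A (basisSph i : EuclideanSpace ℝ (Fin d))‖ := by
  rw [slNorm_eq]
  refine ContinuousLinearMap.opNorm_le_bound _ (by positivity) fun x => ?_
  conv_lhs => rw [← (EuclideanSpace.basisFun (Fin d) ℝ).sum_repr x, map_sum]
  refine (norm_sum_le _ _).trans ?_
  rw [Finset.sum_mul]
  refine Finset.sum_le_sum fun i _ => ?_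
  rw [map_smul, norm_smul, mul_comm, basisSph_coe]
  exact mul_le_mul_of_nonneg_left (PiLp.norm_apply_le x i) (norm_nonneg _)

theorem euclidean_norm_le_sum {d : ℕ} (x : EuclideanSpace ℝ (Fin d)) : ‖x‖ ≤ ∑ i, |x i| := by
  conv_lhs => rw [← (EuclideanSpace.basisFun (Fin d) ℝ).sum_repr x]
  refine (norm_sum_le _ _).trans (Finset.sum_le_sum fun i _ => ?_)
  rw [norm_smul, (EuclideanSpace.basisFun (Fin d) ℝ).orthonormal.1 i, mul_one]
  rfl

theorem slVec_basisSph_apply {d : ℕ} (A : SL d) (i j : Fin d) :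
    slVec A (basisSph j : EuclideanSpace ℝ (Fin d)) i = A i j := by
  simp [slVec, basisSph]

theorem abs_entry_le_slNorm {d : ℕ} (A : SL d) (i j : Fin d) : |A i j| ≤ slNorm A := by
  rw [← slVec_basisSph_apply]
  exact (PiLp.norm_apply_le _ i).trans (norm_slVec_sph_le A _)

theorem slNorm_inv_le {d : ℕ} (A : SL d) :
    slNorm A⁻¹ ≤ d * d * d.factorial * (max 1 (slNorm A)) ^ d := by
  have hent (i j : Fin d) : |A⁻¹ i j| ≤ d.factorial * (max 1 (slNorm A)) ^ d := by
    have h1 : A⁻¹ i j = ((A : Matrix (Fin d) (Fin d) ℝ).updateRow j (Pi.single i 1)).det := by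
      rw [Matrix.SpecialLinearGroup.coe_inv, Matrix.adjugate_apply]
    rw [h1]
    have h2 := Matrix.det_le (abv := (AbsoluteValue.abs : AbsoluteValue ℝ ℝ))
      (A := (A : Matrix (Fin d) (Fin d) ℝ).updateRow j (Pi.single i 1)) (x := max 1 (slNorm A)) ?_
    · simpa using h2
    · intro k l
      rw [Matrix.updateRow_apply, AbsoluteValue.abs_apply]
      split_ifs with h
      · rw [Pi.single_apply]
        split_ifs <;> simp
      · exact (abs_entry_le_slNorm A k l).trans (le_max_right _ _)
  calc slNorm A⁻¹ ≤ ∑ j : Fin d, ‖slVec A⁻¹ (basisSph j : EuclideanSpace ℝ (Fin d))‖ := slNorm_le_sum _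
    _ ≤ ∑ j : Fin d, ∑ i : Fin d, d.factorial * (max 1 (slNorm A)) ^ d := by
        refine Finset.sum_le_sum fun j _ => (euclidean_norm_le_sum _).trans
          (Finset.sum_le_sum fun i _ => ?_)
        rw [slVec_basisSph_apply]
        exact hent i j
    _ = _ := by simp; ring

/-- The logarithmic size of a matrix. -/
def logSize {d : ℕ} (A : SL d) : ℝ := max (Real.log (slNorm A)) (Real.log (slNorm A⁻¹))

theorem continuous_log_slNorm {d : ℕ} [NeZero d] :
    Continuous (fun A : SL d => Real.log (slNorm A)) :=
  continuous_slNorm.log fun A => (slNorm_pos A).ne'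

theorem continuous_log_norm_slVec {d : ℕ} (x : Sph d) :
    Continuous (fun A : SL d => Real.log ‖slVec A (x : EuclideanSpace ℝ (Fin d))‖) := by
  have := continuous_slVec (d := d)
  exact Continuous.log (by fun_prop) fun A => (norm_slVec_pos A x).ne'

theorem continuous_logSize {d : ℕ} [NeZero d] : Continuous (logSize (d := d)) :=
  continuous_log_slNorm.max (continuous_log_slNorm.comp continuous_inv)

theorem log_norm_slVec_le {d : ℕ} (A : SL d) (x : Sph d) :
    Real.log ‖slVec A (x : EuclideanSpace ℝ (Fin d))‖ ≤ Real.log (slNorm A) :=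
  Real.log_le_log (norm_slVec_pos A x) (norm_slVec_sph_le A x)

theorem neg_logSize_le {d : ℕ} [NeZero d] (A : SL d) (x : Sph d) :
    -logSize A ≤ Real.log ‖slVec A (x : EuclideanSpace ℝ (Fin d))‖ := by
  have h := Real.log_nonneg (one_le_slNorm_inv_mul A x)
  rw [Real.log_mul (slNorm_pos _).ne' (norm_slVec_pos A x).ne'] at h
  have := le_max_right (Real.log (slNorm A)) (Real.log (slNorm A⁻¹))
  rw [← logSize] at this
  linarith

theorem log_slNorm_le_logSize {d : ℕ} (A : SL d) : Real.log (slNorm A) ≤ logSize A :=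
  le_max_left _ _

theorem abs_log_norm_slVec_le {d : ℕ} [NeZero d] (A : SL d) (x : Sph d) :
    |Real.log ‖slVec A (x : EuclideanSpace ℝ (Fin d))‖| ≤ logSize A :=
  abs_le.2 ⟨neg_logSize_le A x, (log_norm_slVec_le A x).trans (log_slNorm_le_logSize A)⟩

theorem abs_log_slNorm_le {d : ℕ} [NeZero d] (A : SL d) : |Real.log (slNorm A)| ≤ logSize A :=
  abs_le.2 ⟨(neg_logSize_le A (basisSph 0)).trans (log_norm_slVec_le A _), log_slNorm_le_logSize A⟩

theorem logSize_nonneg {d : ℕ} [NeZero d] (A : SL d) : 0 ≤ logSize A :=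
  (abs_nonneg _).trans (abs_log_slNorm_le A)

theorem logSize_one {d : ℕ} [NeZero d] : logSize (1 : SL d) = 0 := by
  simp [logSize, slNorm_one]

theorem log_slNorm_mul_le {d : ℕ} [NeZero d] (A B : SL d) :
    Real.log (slNorm (A * B)) ≤ Real.log (slNorm A) + Real.log (slNorm B) := by
  rw [← Real.log_mul (slNorm_pos A).ne' (slNorm_pos B).ne']
  exact Real.log_le_log (slNorm_pos _) (slNorm_mul_le A B)

theorem logSize_mul_le {d : ℕ} [NeZero d] (A B : SL d) :
    logSize (A * B) ≤ logSize A + logSize B := by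
  refine max_le ((log_slNorm_mul_le A B).trans
    (add_le_add (le_max_left _ _) (le_max_left _ _))) ?_
  rw [_root_.mul_inv_rev, add_comm]
  exact (log_slNorm_mul_le _ _).trans (add_le_add (le_max_right _ _) (le_max_right _ _))

theorem exp_logSize_le {d : ℕ} [NeZero d] (A : SL d) :
    Real.exp (logSize A) ≤ d * d * d.factorial * (max 1 (slNorm A)) ^ d := by
  have hd : (1 : ℝ) ≤ d := by exact_mod_cast NeZero.one_le
  have hf : (1 : ℝ) ≤ d.factorial := by exact_mod_cast Nat.one_le_of_lt d.factorial_pos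
  have h1 : (1 : ℝ) ≤ max 1 (slNorm A) := le_max_left _ _
  rw [logSize, Monotone.map_max Real.exp_monotone, Real.exp_log (slNorm_pos _),
    Real.exp_log (slNorm_pos _)]
  refine max_le ?_ (slNorm_inv_le A)
  calc slNorm A ≤ max 1 (slNorm A) := le_max_right _ _
    _ ≤ (max 1 (slNorm A)) ^ d := le_self_pow₀ h1 (NeZero.ne d)
    _ ≤ _ := le_mul_of_one_le_left (by positivity)
        (one_le_mul_of_one_le_of_one_le (one_le_mul_of_one_le_of_one_le hd hd) hf)

/-- The finite moment condition bounds exponential moments of `logSize` uniformly. -/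
theorem exists_lintegral_exp_logSize_le {d : ℕ} [NeZero d] {K : Set (ProbabilityMeasure (SL d))}
    {γ C : ℝ} (hγ : 0 < γ) (hmom : ∀ μ ∈ K, FiniteMomentCondition γ C μ) :
    ∃ g : ℝ, 0 < g ∧ ∃ D : ℝ, 1 ≤ D ∧ ∀ μ ∈ K,
      ∫⁻ A, ENNReal.ofReal (Real.exp (g * logSize A)) ∂(μ : Measure (SL d)) ≤
        ENNReal.ofReal D := by
  have hd : (0 : ℝ) < d := by exact_mod_cast NeZero.pos d
  have hd1 : (1 : ℝ) ≤ d := by exact_mod_cast NeZero.one_le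
  have hf : (1 : ℝ) ≤ d.factorial := by exact_mod_cast Nat.one_le_of_lt d.factorial_pos
  set c : ℝ := d * d * d.factorial
  have hc : 1 ≤ c := one_le_mul_of_one_le_of_one_le (one_le_mul_of_one_le_of_one_le hd1 hd1) hf
  have hc0 : 0 < c := one_pos.trans_le hc
  set c' : ℝ := c ^ (γ / d)
  have hc' : 1 ≤ c' := Real.one_le_rpow hc (by positivity)
  refine ⟨γ / d, by positivity, c' * (1 + max C 0), ?_, fun μ hμ => ?_⟩
  · exact one_le_mul_of_one_le_of_one_le hc' (by linarith [le_max_right C 0])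
  have hpt (A : SL d) : Real.exp (γ / d * logSize A) ≤ c' * (1 + slNorm A ^ γ) := by
    have hA := slNorm_pos A
    calc Real.exp (γ / d * logSize A) = Real.exp (logSize A) ^ (γ / d) := by
          rw [← Real.exp_mul, mul_comm]
      _ ≤ (c * (max 1 (slNorm A)) ^ d) ^ (γ / d) :=
          Real.rpow_le_rpow (Real.exp_pos _).le (exp_logSize_le A) (by positivity)
      _ = c' * (max 1 (slNorm A)) ^ γ := by
          rw [Real.mul_rpow hc0.le (by positivity), ← Real.rpow_natCast, ← Real.rpow_mul
            (by positivity), mul_div_cancel₀ _ hd.ne']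
      _ ≤ c' * (1 + slNorm A ^ γ) := by
          gcongr
          rcases max_cases 1 (slNorm A) with ⟨h, -⟩ | ⟨h, -⟩ <;> rw [h]
          · rw [Real.one_rpow]
            linarith [Real.rpow_nonneg hA.le γ]
          · linarith
  calc ∫⁻ A, ENNReal.ofReal (Real.exp (γ / d * logSize A)) ∂(μ : Measure (SL d))
      ≤ ∫⁻ A, ENNReal.ofReal c' * (1 + ENNReal.ofReal (slNorm A ^ γ))
          ∂(μ : Measure (SL d)) := by
        refine lintegral_mono fun A => ?_
        rw [← ENNReal.ofReal_one, ← ENNReal.ofReal_add zero_le_one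
          (Real.rpow_nonneg (slNorm_pos A).le γ), ← ENNReal.ofReal_mul (by positivity)]
        exact ENNReal.ofReal_le_ofReal (hpt A)
    _ = ENNReal.ofReal c' * (1 + ∫⁻ A, ENNReal.ofReal (slNorm A ^ γ) ∂(μ : Measure (SL d))) := by
        rw [lintegral_const_mul' _ _ ENNReal.ofReal_ne_top, lintegral_add_left measurable_const]
        simp
    _ ≤ ENNReal.ofReal c' * (1 + ENNReal.ofReal (max C 0)) := by
        gcongr
        exact (hmom μ hμ).le.trans (ENNReal.ofReal_le_ofReal (le_max_left _ _))
    _ = ENNReal.ofReal (c' * (1 + max C 0)) := by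
        rw [ENNReal.ofReal_mul (by positivity), ENNReal.ofReal_add zero_le_one (le_max_right _ _),
          ENNReal.ofReal_one]

/-- Uniform exponential moment bound for a set of measures. -/
def ExpMoment {d : ℕ} (K : Set (ProbabilityMeasure (SL d))) (g D : ℝ) : Prop :=
  ∀ μ ∈ K, ∫⁻ A, ENNReal.ofReal (Real.exp (g * logSize A)) ∂(μ : Measure (SL d)) ≤
    ENNReal.ofReal D

theorem measurable_ofReal_exp_logSize {d : ℕ} [NeZero d] (g : ℝ) :
    Measurable (fun A : SL d => ENNReal.ofReal (Real.exp (g * logSize A))) := by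
  have := (continuous_logSize (d := d)).measurable
  fun_prop

theorem ExpMoment.lintegral_law_le {d : ℕ} [NeZero d] {K : Set (ProbabilityMeasure (SL d))}
    {g D : ℝ} (h : ExpMoment K g D) (hg : 0 ≤ g) (hD : 0 ≤ D) {μ : ℕ → ProbabilityMeasure (SL d)}
    (hμ : ∀ i, μ i ∈ K) (n : ℕ) :
    ∫⁻ A, ENNReal.ofReal (Real.exp (g * logSize A)) ∂law μ n ≤ ENNReal.ofReal (D ^ n) := by
  have hm := measurable_ofReal_exp_logSize (d := d) g
  induction n with
  | zero =>
    rw [law, lintegral_dirac' _ hm, logSize_one]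
    simp
  | succ n ih =>
    rw [law, Measure.lintegral_mconv hm]
    calc ∫⁻ B, ∫⁻ A, ENNReal.ofReal (Real.exp (g * logSize (B * A))) ∂law μ n
          ∂(μ n : Measure (SL d))
        ≤ ∫⁻ B, ∫⁻ A, ENNReal.ofReal (Real.exp (g * logSize B)) *
            ENNReal.ofReal (Real.exp (g * logSize A)) ∂law μ n ∂(μ n : Measure (SL d)) := by
          refine lintegral_mono fun B => lintegral_mono fun A => ?_
          rw [← ENNReal.ofReal_mul (Real.exp_pos _).le, ← Real.exp_add, ← mul_add]
          gcongr
          exact logSize_mul_le B A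
      _ = (∫⁻ B, ENNReal.ofReal (Real.exp (g * logSize B)) ∂(μ n : Measure (SL d))) *
            ∫⁻ A, ENNReal.ofReal (Real.exp (g * logSize A)) ∂law μ n := by
          simp_rw [lintegral_const_mul' _ _ ENNReal.ofReal_ne_top]
          rw [lintegral_mul_const _ hm]
      _ ≤ ENNReal.ofReal D * ENNReal.ofReal (D ^ n) := mul_le_mul' (h _ (hμ n)) ih
      _ = ENNReal.ofReal (D ^ (n + 1)) := by
          rw [← ENNReal.ofReal_mul hD, pow_succ']

/-! ### Comparison of `‖Tₙ‖` and `|Tₙ v|` in expectation -/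

/-- Vectors that are not nearly orthogonal to some direction `u` are expanded almost maximally. -/
theorem exists_inner_mul_slNorm_le {d : ℕ} [NeZero d] (B : SL d) :
    ∃ u : Sph d, ∀ x : Sph d,
      |inner ℝ (u : EuclideanSpace ℝ (Fin d)) x| * (slNorm B / 2) ≤
        ‖slVec B (x : EuclideanSpace ℝ (Fin d))‖ := by
  have hB := slNorm_pos B
  have hlt : slNorm B / 2 < ‖ContinuousLinearMap.adjoint (slCLM B)‖ := by
    rw [LinearIsometryEquiv.norm_map, ← slNorm_eq]
    linarith
  obtain ⟨y, hy1, hy2⟩ := ContinuousLinearMap.exists_lt_apply_of_lt_opNorm _ hlt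
  set z := ContinuousLinearMap.adjoint (slCLM B) y
  have hz : 0 < ‖z‖ := lt_trans (by positivity) hy2
  refine ⟨⟨‖z‖⁻¹ • z, ?_⟩, fun x => ?_⟩
  · rw [mem_sphere_zero_iff_norm, norm_smul, norm_inv, norm_norm, inv_mul_cancel₀ hz.ne']
  · have h1 : |inner ℝ z (x : EuclideanSpace ℝ (Fin d))| ≤
        ‖slVec B (x : EuclideanSpace ℝ (Fin d))‖ := by
      rw [ContinuousLinearMap.adjoint_inner_left]
      refine (abs_real_inner_le_norm _ _).trans ?_
      exact mul_le_of_le_one_left (norm_nonneg _) hy1.le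
    calc |inner ℝ (‖z‖⁻¹ • z) (x : EuclideanSpace ℝ (Fin d))| * (slNorm B / 2)
        ≤ |inner ℝ (‖z‖⁻¹ • z) (x : EuclideanSpace ℝ (Fin d))| * ‖z‖ := by gcongr
      _ = |inner ℝ z (x : EuclideanSpace ℝ (Fin d))| := by
          rw [inner_smul_left, abs_mul]
          simp only [conj_trivial, abs_inv, abs_norm]
          field_simp
      _ ≤ _ := h1

/-- Growth lost by the direction `x`, compared to the norm. -/
def logGap {d : ℕ} (x : Sph d) (A : SL d) : ℝ :=
  Real.log (slNorm A) - Real.log ‖slVec A (x : EuclideanSpace ℝ (Fin d))‖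

theorem logGap_nonneg {d : ℕ} (x : Sph d) (A : SL d) : 0 ≤ logGap x A :=
  sub_nonneg.2 (log_norm_slVec_le A x)

theorem continuous_logGap {d : ℕ} [NeZero d] (x : Sph d) : Continuous (logGap x) :=
  continuous_log_slNorm.sub (continuous_log_norm_slVec x)

theorem logGap_le {d : ℕ} [NeZero d] (x : Sph d) (A : SL d) : logGap x A ≤ 2 * logSize A := by
  have h1 := log_slNorm_le_logSize A
  have h2 := neg_logSize_le A x
  rw [logGap]
  linarith

theorem logGap_mul_le {d : ℕ} [NeZero d] {κ : ℝ} (hκ : 0 < κ) (x : Sph d) (A B : SL d)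
    {u : Sph d} (hu : ∀ x : Sph d, |inner ℝ (u : EuclideanSpace ℝ (Fin d)) x| * (slNorm B / 2) ≤
        ‖slVec B (x : EuclideanSpace ℝ (Fin d))‖)
    (h : κ < |inner ℝ (u : EuclideanSpace ℝ (Fin d)) (sphAct (A, x))|) :
    logGap x (B * A) ≤ -Real.log (κ / 2) + 2 * logSize A := by
  have hB := slNorm_pos B
  have h1 : κ / 2 * slNorm B ≤ ‖slVec B (sphAct (A, x) : EuclideanSpace ℝ (Fin d))‖ := by
    refine le_trans ?_ (hu _)
    nlinarith
  have h2 := Real.log_le_log (by positivity) h1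
  rw [Real.log_mul (by positivity) hB.ne'] at h2
  have h3 := log_slNorm_mul_le B A
  have h4 := logGap_le x A
  rw [logGap] at h4 ⊢
  rw [norm_slVec_mul, Real.log_mul (norm_slVec_pos _ _).ne' (norm_slVec_pos _ _).ne']
  linarith

theorem lintegral_logGap_mul_le {d : ℕ} [NeZero d] {κ : ℝ} (hκ : 0 < κ) (hκ1 : κ ≤ 1)
    {ε : ℝ≥0∞} {x : Sph d} {P : Measure (SL d)} [IsProbabilityMeasure P]
    (hP : ∀ u : Sph d, P {A | |inner ℝ (u : EuclideanSpace ℝ (Fin d)) (sphAct (A, x))| ≤ κ} ≤ ε)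
    {g a : ℝ} (hg : 0 ≤ g) (ha : 0 ≤ a) (B : SL d) :
    ∫⁻ A, ENNReal.ofReal (g * logGap x (B * A)) ∂P ≤
      (ENNReal.ofReal (g * -Real.log (κ / 2)) + ENNReal.ofReal (2 * a) * ε +
        2 * ∫⁻ A, ENNReal.ofReal (Real.exp (g * logSize A)) ∂P) +
      ENNReal.ofReal (2 * Real.exp (-a)) *
        ∫⁻ A, ENNReal.ofReal (Real.exp (g * logSize (B * A))) ∂P := by
  obtain ⟨u, hu⟩ := exists_inner_mul_slNorm_le B
  set S : Set (SL d) := {A | |inner ℝ (u : EuclideanSpace ℝ (Fin d)) (sphAct (A, x))| ≤ κ}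
  have hS : MeasurableSet S := by
    have h1 : Continuous (fun A : SL d => sphAct (A, x)) := by
      have := continuous_sphAct (d := d)
      fun_prop
    have h2 : Continuous (fun y : Sph d => |inner ℝ (u : EuclideanSpace ℝ (Fin d)) y|) := by
      fun_prop
    have h3 := Continuous.comp h2 h1
    exact (isClosed_le h3 continuous_const).measurableSet
  have hlog : 0 ≤ -Real.log (κ / 2) := by
    have := Real.log_nonpos (x := κ / 2) (by positivity) (by linarith)
    linarith
  have hpt (A : SL d) : ENNReal.ofReal (g * logGap x (B * A)) ≤
      ((ENNReal.ofReal (g * -Real.log (κ / 2)) + S.indicator (fun _ => ENNReal.ofReal (2 * a)) A) +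
        2 * ENNReal.ofReal (Real.exp (g * logSize A))) +
      ENNReal.ofReal (2 * Real.exp (-a)) *
        ENNReal.ofReal (Real.exp (g * logSize (B * A))) := by
    have htwo : (2 : ℝ≥0∞) = ENNReal.ofReal 2 := by simp
    rw [← ENNReal.ofReal_mul (by positivity), htwo, ← ENNReal.ofReal_mul (by positivity)]
    have e1 := Real.add_one_le_exp (g * logSize A)
    have e2 := Real.add_one_le_exp (-a + g * logSize (B * A))
    rw [Real.exp_add] at e2
    have e3 : 0 ≤ g * logSize A := mul_nonneg hg (logSize_nonneg A)
    have e4 : 0 ≤ g * -Real.log (κ / 2) := mul_nonneg hg hlog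
    by_cases hA : A ∈ S
    · rw [Set.indicator_of_mem hA, ← ENNReal.ofReal_add e4 (by positivity),
        ← ENNReal.ofReal_add (by positivity) (by positivity),
        ← ENNReal.ofReal_add (by positivity) (by positivity)]
      apply ENNReal.ofReal_le_ofReal
      have := mul_le_mul_of_nonneg_left (logGap_le x (B * A)) hg
      nlinarith
    · rw [Set.indicator_of_notMem hA, add_zero, ← ENNReal.ofReal_add e4 (by positivity),
        ← ENNReal.ofReal_add (by positivity) (by positivity)]
      apply ENNReal.ofReal_le_ofReal
      have := mul_le_mul_of_nonneg_left (logGap_mul_le hκ x A B hu (not_le.1 hA)) hg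
      have e5 : 0 ≤ 2 * Real.exp (-a) * Real.exp (g * logSize (B * A)) := by positivity
      nlinarith
  have hm := measurable_ofReal_exp_logSize (d := d) g
  refine (lintegral_mono hpt).trans ?_
  rw [lintegral_add_left (by fun_prop (disch := assumption)),
    lintegral_add_left (by fun_prop (disch := assumption)), lintegral_add_left measurable_const,
    lintegral_const_mul' _ _ ENNReal.ofReal_ne_top, lintegral_const_mul' _ _ (by simp),
    lintegral_indicator hS, setLIntegral_const, lintegral_const, measure_univ, mul_one]
  gcongr
  exact hP u

/-- In expectation, the growth of any direction is close to that of the norm. -/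
theorem exists_lintegral_logGap_le {d : ℕ} [NeZero d] {K : Set (ProbabilityMeasure (SL d))}
    (hK : IsCompact K) (hsp : ∀ μ ∈ K, SpacesCondition μ) {g D : ℝ} (hg : 0 < g) (hD : 1 ≤ D)
    (h : ExpMoment K g D) {ε : ℝ} (hε : 0 < ε) :
    ∃ m : ℕ, 0 < m ∧ ∀ μ : ℕ → ProbabilityMeasure (SL d), (∀ i, μ i ∈ K) → ∀ x : Sph d,
      ∫⁻ A, ENNReal.ofReal (logGap x A) ∂law μ m ≤ ENNReal.ofReal (ε * m) := by
  have hD0 : 0 < D := one_pos.trans_le hD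
  have hlogD : 0 ≤ Real.log D := Real.log_nonneg hD
  set ε₀ : ℝ := g * ε / (4 * (Real.log D + 1)) with hε₀
  have hε₀pos : 0 < ε₀ := by positivity
  obtain ⟨l, κ, hκ, hκ1, hmass⟩ := exists_reachSet_mass_hyperplane_le hK hsp
    (ENNReal.ofReal_pos.2 hε₀pos)
  set b : ℝ := -Real.log (κ / 2)
  have hb : 0 ≤ b := by
    have := Real.log_nonpos (x := κ / 2) (by positivity) (by linarith)
    simp only [b]
    linarith
  obtain ⟨k, hk⟩ := exists_nat_ge ((g * b + 2 * D ^ l + 2) / (g * ε / 2))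
  have hk' : g * b + 2 * D ^ l + 2 ≤ k * (g * ε / 2) := (div_le_iff₀ (by positivity)).1 hk
  have hkpos : 0 < k := by
    rcases Nat.eq_zero_or_pos k with rfl | hk0
    · have : 0 ≤ g * b := by positivity
      have : 0 < D ^ l := by positivity
      simp at hk'
      linarith
    · exact hk0
  refine ⟨k + l, by omega, fun μ hμ x => ?_⟩
  set a : ℝ := (k + l : ℕ) * Real.log D with ha
  have hexpa : Real.exp (-a) * D ^ (k + l) = 1 := by
    rw [ha, ← Real.log_pow, Real.exp_neg, Real.exp_log (by positivity)]
    exact inv_mul_cancel₀ (by positivity)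
  have hmeas : Measurable (fun A : SL d => ENNReal.ofReal (g * logGap x A)) := by
    have := (continuous_logGap x).measurable
    fun_prop
  have hP (u : Sph d) : law μ l
      {A | |inner ℝ (u : EuclideanSpace ℝ (Fin d)) (sphAct (A, x))| ≤ κ} ≤
        ENNReal.ofReal ε₀ := by
    obtain ⟨ν, hν, hνeq⟩ := exists_mem_reachSet_eq_map hμ x l
    have h1 := hmass ν hν u
    rwa [hνeq, Measure.map_apply] at h1
    · have := continuous_sphAct (d := d)
      exact Continuous.measurable (by fun_prop)
    · exact (isClosed_le (by fun_prop) continuous_const).measurableSet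
  have hm := measurable_ofReal_exp_logSize (d := d) g
  have hmain : ∫⁻ A, ENNReal.ofReal (g * logGap x A) ∂law μ (k + l) ≤
      ENNReal.ofReal (g * (ε * (k + l : ℕ))) := by
    rw [lintegral_law_add μ k l hmeas]
    refine (lintegral_mono fun B => lintegral_logGap_mul_le hκ hκ1 hP hg.le
      (show 0 ≤ a by positivity) B).trans ?_
    rw [lintegral_add_left measurable_const, lintegral_const_mul' _ _ ENNReal.ofReal_ne_top,
      ← lintegral_law_add μ k l hm, lintegral_const, measure_univ, mul_one]
    calc _ ≤ ENNReal.ofReal (g * b) + ENNReal.ofReal (2 * a) * ENNReal.ofReal ε₀ +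
          ENNReal.ofReal 2 * ENNReal.ofReal (D ^ l) +
          ENNReal.ofReal (2 * Real.exp (-a)) * ENNReal.ofReal (D ^ (k + l)) := by
          rw [show ENNReal.ofReal 2 = 2 by simp]
          gcongr
          · exact h.lintegral_law_le hg.le hD0.le hμ l
          · exact h.lintegral_law_le hg.le hD0.le hμ (k + l)
      _ = ENNReal.ofReal (g * b + 2 * a * ε₀ + 2 * D ^ l + 2) := by
          rw [← ENNReal.ofReal_mul (by positivity), ← ENNReal.ofReal_mul (by positivity),
            ← ENNReal.ofReal_mul (by positivity), mul_assoc 2 (Real.exp (-a)), hexpa, mul_one,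
            ← ENNReal.ofReal_add (by positivity) (by positivity),
            ← ENNReal.ofReal_add (by positivity) (by positivity),
            ← ENNReal.ofReal_add (by positivity) (by positivity)]
      _ ≤ _ := by
          apply ENNReal.ofReal_le_ofReal
          have h1 : 2 * a * ε₀ ≤ (k + l : ℕ) * (g * ε / 2) := by
            have : 2 * a * ε₀ = (k + l : ℕ) * (g * ε / 2) * (Real.log D / (Real.log D + 1)) := by
              rw [ha, hε₀]
              field_simp
              ring
            rw [this]
            refine mul_le_of_le_one_right (by positivity) ?_
            rw [div_le_one (by positivity)]
            linarith
          have h2 : (k : ℝ) * (g * ε / 2) ≤ (k + l : ℕ) * (g * ε / 2) := by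
            gcongr
            omega
          linarith
  simp_rw [ENNReal.ofReal_mul hg.le] at hmain
  rw [lintegral_const_mul' _ _ ENNReal.ofReal_ne_top] at hmain
  exact (ENNReal.mul_le_mul_iff_right (ENNReal.ofReal_pos.2 hg).ne' ENNReal.ofReal_ne_top).1 hmain

/-! ### Exponential moments of centered quantities -/

theorem exp_le_one_add_add_sq_mul (y : ℝ) : Real.exp y ≤ 1 + y + y ^ 2 * Real.exp |y| := by
  have h1 : 1 ≤ Real.exp |y| := Real.one_le_exp (abs_nonneg y)
  rcases le_or_gt |y| 1 with h | h
  · have h2 := (abs_le.1 (Real.abs_exp_sub_one_sub_id_le h)).2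
    nlinarith [sq_nonneg y]
  · rcases le_or_gt 0 y with h0 | h0
    · rw [abs_of_nonneg h0] at h h1 ⊢
      have : Real.exp y ≤ y ^ 2 * Real.exp y :=
        le_mul_of_one_le_left (Real.exp_pos y).le (one_le_pow₀ h.le)
      linarith
    · rw [abs_of_neg h0] at h h1 ⊢
      have h3 : Real.exp y ≤ 1 := Real.exp_le_one_iff.2 h0.le
      nlinarith [sq_nonneg y]

section CenteredMoments

variable {Ω : Type*} [MeasurableSpace Ω] {P : Measure Ω} {g B : ℝ} {Z W : Ω → ℝ}

theorem integrable_of_lintegral_ofReal_le {f : Ω → ℝ} (hf : Measurable f) (h0 : ∀ ω, 0 ≤ f ω)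
    (h : ∫⁻ ω, ENNReal.ofReal (f ω) ∂P ≤ ENNReal.ofReal B) : Integrable f P :=
  (lintegral_ofReal_ne_top_iff_integrable hf.aestronglyMeasurable (ae_of_all _ h0)).1
    (ne_top_of_le_ne_top ENNReal.ofReal_ne_top h)

theorem integral_le_of_lintegral_ofReal_le {f : Ω → ℝ} (hf : Measurable f) (h0 : ∀ ω, 0 ≤ f ω)
    (hB : 0 ≤ B) (h : ∫⁻ ω, ENNReal.ofReal (f ω) ∂P ≤ ENNReal.ofReal B) : ∫ ω, f ω ∂P ≤ B := by
  rw [← ofReal_integral_eq_lintegral_ofReal (integrable_of_lintegral_ofReal_le hf h0 h)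
    (ae_of_all _ h0)] at h
  exact (ENNReal.ofReal_le_ofReal_iff hB).1 h

theorem le_exp_mul_div (hg : 0 < g) (w : ℝ) : w ≤ Real.exp (g * w) / g := by
  rw [le_div_iff₀ hg]
  linarith [Real.add_one_le_exp (g * w)]

theorem integrable_of_abs_le_of_lintegral_exp_le (hg : 0 < g) (hZ : Measurable Z)
    (hW : Measurable W) (hZW : ∀ ω, |Z ω| ≤ W ω)
    (hexp : ∫⁻ ω, ENNReal.ofReal (Real.exp (g * W ω)) ∂P ≤ ENNReal.ofReal B) :
    Integrable Z P :=
  ((integrable_of_lintegral_ofReal_le (by fun_prop) (fun _ => (Real.exp_pos _).le)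
    hexp).div_const g).mono' hZ.aestronglyMeasurable
    (ae_of_all _ fun ω => (hZW ω).trans (le_exp_mul_div hg _))

/-- Exponential moments of a variable with small mean, for small parameters. -/
theorem lintegral_exp_mul_le [IsProbabilityMeasure P] (hg : 0 < g) (hB : 0 ≤ B)
    (hZ : Measurable Z) (hW : Measurable W) (hZW : ∀ ω, |Z ω| ≤ W ω)
    (hexp : ∫⁻ ω, ENNReal.ofReal (Real.exp (g * W ω)) ∂P ≤ ENNReal.ofReal B)
    {η : ℝ} (hmean : ∫ ω, Z ω ∂P ≤ η) {s : ℝ} (hs : 0 < s) (hsg : s ≤ g / 2) :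
    ∫⁻ ω, ENNReal.ofReal (Real.exp (s * Z ω)) ∂P ≤
      ENNReal.ofReal (Real.exp (s * η + s ^ 2 * (8 / g ^ 2 * B))) := by
  have hE : Integrable (fun ω => Real.exp (g * W ω)) P :=
    integrable_of_lintegral_ofReal_le (by fun_prop) (fun _ => (Real.exp_pos _).le) hexp
  have hEB : ∫ ω, Real.exp (g * W ω) ∂P ≤ B :=
    integral_le_of_lintegral_ofReal_le (by fun_prop) (fun _ => (Real.exp_pos _).le) hB hexp
  have hZi := integrable_of_abs_le_of_lintegral_exp_le hg hZ hW hZW hexp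
  have hpt (ω : Ω) : Real.exp (s * Z ω) ≤
      1 + s * Z ω + s ^ 2 * (8 / g ^ 2) * Real.exp (g * W ω) := by
    have hw : 0 ≤ W ω := (abs_nonneg _).trans (hZW ω)
    refine (exp_le_one_add_add_sq_mul _).trans (add_le_add_right ?_ _)
    have h1 : W ω ^ 2 ≤ 8 / g ^ 2 * Real.exp (g * W ω / 2) := by
      have := Real.quadratic_le_exp_of_nonneg (x := g * W ω / 2) (by positivity)
      rw [div_mul_eq_mul_div, le_div_iff₀ (by positivity)]
      have : 0 ≤ g * W ω := by positivity
      nlinarith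
    have h2 : (s * Z ω) ^ 2 ≤ s ^ 2 * W ω ^ 2 := by
      rw [mul_pow, ← sq_abs (Z ω)]
      gcongr
      exact hZW ω
    have h3 : Real.exp |s * Z ω| ≤ Real.exp (g * W ω / 2) := by
      rw [abs_mul, abs_of_pos hs]
      apply Real.exp_le_exp.2
      calc s * |Z ω| ≤ g / 2 * W ω := by
            gcongr
            exact hZW ω
        _ = _ := by ring
    calc (s * Z ω) ^ 2 * Real.exp |s * Z ω|
        ≤ (s ^ 2 * (8 / g ^ 2 * Real.exp (g * W ω / 2))) * Real.exp (g * W ω / 2) := by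
          gcongr
          exact h2.trans (by gcongr)
      _ = s ^ 2 * (8 / g ^ 2) * (Real.exp (g * W ω / 2) * Real.exp (g * W ω / 2)) := by ring
      _ = _ := by
          rw [← Real.exp_add]
          congr 2
          ring
  have hlin : Integrable (fun ω => 1 + s * Z ω) P := (integrable_const 1).add (hZi.const_mul s)
  have hrhs : Integrable (fun ω => 1 + s * Z ω + s ^ 2 * (8 / g ^ 2) * Real.exp (g * W ω)) P :=
    hlin.add (hE.const_mul _)
  have hlhs : Integrable (fun ω => Real.exp (s * Z ω)) P :=
    hrhs.mono' (by fun_prop) (ae_of_all _ fun ω => by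
      rw [Real.norm_of_nonneg (Real.exp_pos _).le]
      exact hpt ω)
  rw [← ofReal_integral_eq_lintegral_ofReal hlhs (ae_of_all _ fun _ => (Real.exp_pos _).le)]
  apply ENNReal.ofReal_le_ofReal
  calc ∫ ω, Real.exp (s * Z ω) ∂P
      ≤ ∫ ω, (1 + s * Z ω + s ^ 2 * (8 / g ^ 2) * Real.exp (g * W ω)) ∂P :=
        integral_mono hlhs hrhs hpt
    _ = 1 + s * ∫ ω, Z ω ∂P + s ^ 2 * (8 / g ^ 2) * ∫ ω, Real.exp (g * W ω) ∂P := by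
        rw [integral_add hlin (hE.const_mul _),
          integral_add (integrable_const 1) (hZi.const_mul s), integral_const_mul,
          integral_const_mul]
        simp
    _ ≤ 1 + s * η + s ^ 2 * (8 / g ^ 2) * B := by gcongr
    _ ≤ Real.exp (s * η + s ^ 2 * (8 / g ^ 2 * B)) := by
        have := Real.add_one_le_exp (s * η + s ^ 2 * (8 / g ^ 2 * B))
        linarith

/-- Jensen's inequality, as a bound on the mean. -/
theorem mul_integral_sub_le [IsProbabilityMeasure P] (hZ : Integrable Z P) (hZm : Measurable Z)
    {t c a : ℝ} (h : ∫⁻ ω, ENNReal.ofReal (Real.exp (t * (Z ω - c))) ∂P ≤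
      ENNReal.ofReal (Real.exp a)) : t * (∫ ω, Z ω ∂P - c) ≤ a := by
  have h1 := integral_le_of_lintegral_ofReal_le (by fun_prop) (fun _ => (Real.exp_pos _).le)
    (Real.exp_pos a).le h
  have hi : Integrable (fun ω => Real.exp (t * (Z ω - c))) P :=
    integrable_of_lintegral_ofReal_le (by fun_prop) (fun _ => (Real.exp_pos _).le) h
  have hZc : Integrable (fun ω => t * (Z ω - c)) P :=
    (hZ.sub (integrable_const c)).const_mul t
  have h2 : ∫ ω, Real.exp a * (1 - a + t * (Z ω - c)) ∂P ≤ ∫ ω, Real.exp (t * (Z ω - c)) ∂P := by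
    refine integral_mono (((integrable_const _).add hZc).const_mul _) hi fun ω => ?_
    have := Real.add_one_le_exp (t * (Z ω - c) - a)
    rw [Real.exp_sub, le_div_iff₀ (Real.exp_pos a)] at this
    linarith
  rw [integral_const_mul, integral_add (integrable_const _) hZc, integral_const_mul,
    integral_sub hZ (integrable_const c)] at h2
  simp only [integral_const, probReal_univ, smul_eq_mul, one_mul] at h2
  have h3 := h2.trans h1
  nlinarith [Real.exp_pos a]

/-- Two-sided Chernoff bound. -/
theorem measure_lt_abs_sub_le {s c a r : ℝ} (hZm : Measurable Z) (hs : 0 < s)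
    (h : ∀ t, |t| = s → ∫⁻ ω, ENNReal.ofReal (Real.exp (t * (Z ω - c))) ∂P ≤
      ENNReal.ofReal (Real.exp a)) :
    P {ω | r < |Z ω - c|} ≤ ENNReal.ofReal (2 * Real.exp (a - s * r)) := by
  have key (t : ℝ) (ht : |t| = s) : P {ω | s * r ≤ t * (Z ω - c)} ≤
      ENNReal.ofReal (Real.exp (a - s * r)) := by
    have h1 := mul_meas_ge_le_lintegral₀ (μ := P)
      (f := fun ω => ENNReal.ofReal (Real.exp (t * (Z ω - c)))) (by fun_prop)
      (ENNReal.ofReal (Real.exp (s * r)))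
    have h2 := h1.trans (h t ht)
    simp only [ENNReal.ofReal_le_ofReal_iff (Real.exp_pos _).le, Real.exp_le_exp] at h2
    rw [Real.exp_sub, ENNReal.ofReal_div_of_pos (Real.exp_pos _),
      ENNReal.le_div_iff_mul_le (by simp [Real.exp_pos]) (by simp), mul_comm]
    exact h2
  have hsub : {ω | r < |Z ω - c|} ⊆
      {ω | s * r ≤ s * (Z ω - c)} ∪ {ω | s * r ≤ -s * (Z ω - c)} := by
    intro ω hω
    rcases lt_abs.1 (show r < |Z ω - c| from hω) with h | h
    · left
      exact mul_le_mul_of_nonneg_left h.le hs.le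
    · right
      show s * r ≤ -s * (Z ω - c)
      rw [neg_mul, ← mul_neg]
      exact mul_le_mul_of_nonneg_left h.le hs.le
  refine (measure_mono hsub).trans ((measure_union_le _ _).trans ?_)
  rw [two_mul, ENNReal.ofReal_add (Real.exp_pos _).le (Real.exp_pos _).le]
  exact add_le_add (key s (abs_of_pos hs)) (key (-s) (by rw [abs_neg, abs_of_pos hs]))

end CenteredMoments

/-! ### Exponential moments along blocks -/

/-- Exponential moments of the growth over one block of suitable length. -/
theorem exists_block_moment {d : ℕ} [NeZero d] {K : Set (ProbabilityMeasure (SL d))}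
    (hK : IsCompact K) (hsp : ∀ μ ∈ K, SpacesCondition μ) {g D : ℝ} (hg : 0 < g) (hD : 1 ≤ D)
    (h : ExpMoment K g D) {ε : ℝ} (hε : 0 < ε) :
    ∃ m : ℕ, 0 < m ∧ ∃ s : ℝ, 0 < s ∧ s ≤ g ∧
      ∀ μ : ℕ → ProbabilityMeasure (SL d), (∀ i, μ i ∈ K) → ∃ l : ℝ, ∀ x : Sph d, ∀ t : ℝ,
        |t| = s → ∫⁻ A, ENNReal.ofReal (Real.exp
          (t * (Real.log ‖slVec A (x : EuclideanSpace ℝ (Fin d))‖ - l))) ∂law μ m ≤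
            ENNReal.ofReal (Real.exp (s * (2 * ε * m))) := by
  obtain ⟨m, hm, hgap⟩ := exists_lintegral_logGap_le hK hsp hg hD h hε
  have hD0 : 0 < D := one_pos.trans_le hD
  have hm' : (0 : ℝ) < m := by exact_mod_cast hm
  set b : ℝ := D ^ m / g
  have hb : 0 < b := by positivity
  set B : ℝ := Real.exp (g * b) * D ^ m
  have hB : 0 < B := by positivity
  set Q : ℝ := 8 / g ^ 2 * B
  have hQ : 0 < Q := by positivity
  refine ⟨m, hm, min (g / 2) (ε * m / Q), lt_min (by positivity) (by positivity),
    (min_le_left _ _).trans (by linarith), fun μ hμ => ?_⟩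
  set s : ℝ := min (g / 2) (ε * m / Q) with hs_def
  have hs : 0 < s := lt_min (by positivity) (by positivity)
  have hsQ : s ^ 2 * Q ≤ s * (ε * m) := by
    have : s * Q ≤ ε * m := (le_div_iff₀ hQ).1 (min_le_right _ _)
    nlinarith
  have hσ := (continuous_logSize (d := d)).measurable
  have hlaw := h.lintegral_law_le hg.le hD0.le hμ m
  have hN := (continuous_log_slNorm (d := d)).measurable
  have hNi : Integrable (fun A : SL d => Real.log (slNorm A)) (law μ m) :=
    integrable_of_abs_le_of_lintegral_exp_le hg hN hσ abs_log_slNorm_le hlaw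
  set l : ℝ := ∫ A, Real.log (slNorm A) ∂law μ m
  have hl : |l| ≤ b := by
    have hE : Integrable (fun A : SL d => Real.exp (g * logSize A)) (law μ m) :=
      integrable_of_lintegral_ofReal_le (by fun_prop) (fun _ => (Real.exp_pos _).le) hlaw
    calc |l| ≤ ∫ A, |Real.log (slNorm A)| ∂law μ m := abs_integral_le_integral_abs
      _ ≤ ∫ A, Real.exp (g * logSize A) / g ∂law μ m :=
          integral_mono hNi.abs (hE.div_const g) fun A =>
            (abs_log_slNorm_le A).trans (le_exp_mul_div hg _)
      _ = (∫ A, Real.exp (g * logSize A) ∂law μ m) / g := integral_div _ _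
      _ ≤ b := by
          refine div_le_div_of_nonneg_right ?_ hg.le
          exact integral_le_of_lintegral_ofReal_le (by fun_prop) (fun _ => (Real.exp_pos _).le)
            (by positivity) hlaw
  refine ⟨l, fun x t ht => ?_⟩
  have hX := (continuous_log_norm_slVec x).measurable
  have hXi : Integrable
      (fun A : SL d => Real.log ‖slVec A (x : EuclideanSpace ℝ (Fin d))‖) (law μ m) :=
    integrable_of_abs_le_of_lintegral_exp_le hg hX hσ (fun A => abs_log_norm_slVec_le A x) hlaw
  have hmean : l - ∫ A, Real.log ‖slVec A (x : EuclideanSpace ℝ (Fin d))‖ ∂law μ m ≤ ε * m := by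
    rw [← integral_sub hNi hXi]
    exact integral_le_of_lintegral_ofReal_le (continuous_logGap x).measurable (logGap_nonneg x)
      (by positivity) (hgap μ hμ x)
  have hmean' : ∫ A, Real.log ‖slVec A (x : EuclideanSpace ℝ (Fin d))‖ ∂law μ m ≤ l :=
    integral_mono hXi hNi fun A => log_norm_slVec_le A x
  have hexp : ∫⁻ A, ENNReal.ofReal (Real.exp (g * (logSize A + b))) ∂law μ m ≤
      ENNReal.ofReal B := by
    have (A : SL d) : ENNReal.ofReal (Real.exp (g * (logSize A + b))) =
        ENNReal.ofReal (Real.exp (g * b)) * ENNReal.ofReal (Real.exp (g * logSize A)) := by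
      rw [← ENNReal.ofReal_mul (Real.exp_pos _).le, ← Real.exp_add, mul_add, add_comm]
    simp_rw [this]
    rw [lintegral_const_mul' _ _ ENNReal.ofReal_ne_top, ENNReal.ofReal_mul (Real.exp_pos _).le]
    gcongr
  have key (τ : ℝ) (hτ : |τ| = 1) : ∫⁻ A, ENNReal.ofReal (Real.exp
      (s * (τ * (Real.log ‖slVec A (x : EuclideanSpace ℝ (Fin d))‖ - l)))) ∂law μ m ≤
        ENNReal.ofReal (Real.exp (s * (2 * ε * m))) := by
    refine (lintegral_exp_mul_le (η := ε * m) (W := fun A => logSize A + b) hg hB.le (by fun_prop)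
      (by fun_prop) (fun A => ?_) hexp ?_ hs (min_le_left _ _)).trans ?_
    · rw [abs_mul, hτ, one_mul]
      exact (abs_sub _ _).trans (add_le_add (abs_log_norm_slVec_le A x) hl)
    · rw [integral_const_mul, integral_sub hXi (integrable_const l), integral_const,
        probReal_univ, one_smul]
      have h0 : 0 ≤ ε * m := by positivity
      rcases (abs_eq zero_le_one).1 hτ with rfl | rfl <;> linarith
    · apply ENNReal.ofReal_le_ofReal
      apply Real.exp_le_exp.2
      change s * (ε * m) + s ^ 2 * Q ≤ _
      linarith
  rcases (abs_eq hs.le).1 ht with rfl | rfl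
  · simpa using key 1 (by simp)
  · simpa only [one_mul, mul_neg, neg_mul] using key (-1) (by simp)

/-- Exponential moments of the growth of a direction. -/
theorem exists_vector_moment {d : ℕ} [NeZero d] {K : Set (ProbabilityMeasure (SL d))}
    (hK : IsCompact K) (hsp : ∀ μ ∈ K, SpacesCondition μ) {g D : ℝ} (hg : 0 < g) (hD : 1 ≤ D)
    (h : ExpMoment K g D) {ε : ℝ} (hε : 0 < ε) :
    ∃ s : ℝ, 0 < s ∧ ∃ M : ℝ, 1 ≤ M ∧ ∀ n : ℕ,
      ∀ μ : ℕ → ProbabilityMeasure (SL d), (∀ i, μ i ∈ K) → ∃ c : ℝ, ∀ x : Sph d, ∀ t : ℝ,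
        |t| = s → ∫⁻ A, ENNReal.ofReal (Real.exp
          (t * (Real.log ‖slVec A (x : EuclideanSpace ℝ (Fin d))‖ - c))) ∂law μ n ≤
            ENNReal.ofReal (M * Real.exp (s * (2 * ε * n))) := by
  obtain ⟨m, hm, s, hs, hsg, hblock⟩ := exists_block_moment hK hsp hg hD h hε
  have hD0 : 0 < D := one_pos.trans_le hD
  refine ⟨s, hs, D ^ m, one_le_pow₀ hD, fun n => ?_⟩
  induction n using Nat.strong_induction_on with
  | _ n ih =>
  intro μ hμ
  rcases lt_or_ge n m with hnm | hnm
  · refine ⟨0, fun x t ht => ?_⟩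
    calc _ ≤ ∫⁻ A, ENNReal.ofReal (Real.exp (g * logSize A)) ∂law μ n := by
          refine lintegral_mono fun A => ENNReal.ofReal_le_ofReal (Real.exp_le_exp.2 ?_)
          rw [sub_zero]
          refine (le_abs_self _).trans ?_
          rw [abs_mul, ht]
          exact mul_le_mul hsg (abs_log_norm_slVec_le A x) (abs_nonneg _) hg.le
      _ ≤ ENNReal.ofReal (D ^ n) := h.lintegral_law_le hg.le hD0.le hμ n
      _ ≤ _ := by
          apply ENNReal.ofReal_le_ofReal
          calc D ^ n ≤ D ^ m := pow_le_pow_right₀ hD hnm.le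
            _ ≤ _ := le_mul_of_one_le_right (by positivity) (Real.one_le_exp (by positivity))
  · obtain ⟨k, rfl⟩ := Nat.exists_eq_add_of_le' hnm
    obtain ⟨c', hc'⟩ := ih k (by omega) (fun i => μ (i + m)) (fun i => hμ _)
    obtain ⟨l, hl⟩ := hblock μ hμ
    refine ⟨c' + l, fun x t ht => ?_⟩
    have hX := (continuous_log_norm_slVec x).measurable
    rw [lintegral_law_add_symm μ k m (by fun_prop)]
    have hsplit (A B : SL d) : ENNReal.ofReal (Real.exp (t *
        (Real.log ‖slVec (B * A) (x : EuclideanSpace ℝ (Fin d))‖ - (c' + l)))) =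
        ENNReal.ofReal (Real.exp (t *
          (Real.log ‖slVec A (x : EuclideanSpace ℝ (Fin d))‖ - l))) *
        ENNReal.ofReal (Real.exp (t *
          (Real.log ‖slVec B (sphAct (A, x) : EuclideanSpace ℝ (Fin d))‖ - c'))) := by
      rw [norm_slVec_mul, Real.log_mul (norm_slVec_pos _ _).ne' (norm_slVec_pos _ _).ne',
        ← ENNReal.ofReal_mul (Real.exp_pos _).le, ← Real.exp_add]
      congr 2
      ring
    simp_rw [hsplit]
    calc _ ≤ ∫⁻ A, ENNReal.ofReal (Real.exp (t *
            (Real.log ‖slVec A (x : EuclideanSpace ℝ (Fin d))‖ - l))) *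
            ENNReal.ofReal (D ^ m * Real.exp (s * (2 * ε * k))) ∂law μ m := by
          refine lintegral_mono fun A => ?_
          rw [lintegral_const_mul' _ _ ENNReal.ofReal_ne_top]
          gcongr
          exact hc' (sphAct (A, x)) t ht
      _ ≤ ENNReal.ofReal (Real.exp (s * (2 * ε * m))) *
            ENNReal.ofReal (D ^ m * Real.exp (s * (2 * ε * k))) := by
          rw [lintegral_mul_const' _ _ ENNReal.ofReal_ne_top]
          gcongr
          exact hl x t ht
      _ = _ := by
          rw [← ENNReal.ofReal_mul (Real.exp_pos _).le, mul_left_comm, ← Real.exp_add]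
          congr 3
          push_cast
          ring

theorem exp_mul_log_slNorm_sub_le {d : ℕ} [NeZero d] (A : SL d) (t c : ℝ) :
    Real.exp (t * (Real.log (slNorm A) - c)) ≤ Real.exp (|t| * Real.log d) *
      ∑ i : Fin d, Real.exp
        (t * (Real.log ‖slVec A (basisSph i : EuclideanSpace ℝ (Fin d))‖ - c)) := by
  have hlogd : 0 ≤ Real.log d := Real.log_natCast_nonneg d
  obtain ⟨i, hi⟩ : ∃ i : Fin d, t * Real.log (slNorm A) ≤ |t| * Real.log d +
      t * Real.log ‖slVec A (basisSph i : EuclideanSpace ℝ (Fin d))‖ := by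
    rcases le_or_gt 0 t with ht | ht
    · obtain ⟨i, -, hi⟩ := Finset.exists_max_image Finset.univ
        (fun i : Fin d => ‖slVec A (basisSph i : EuclideanSpace ℝ (Fin d))‖) Finset.univ_nonempty
      refine ⟨i, ?_⟩
      have h1 : slNorm A ≤ d * ‖slVec A (basisSph i : EuclideanSpace ℝ (Fin d))‖ := by
        refine (slNorm_le_sum A).trans ((Finset.sum_le_card_nsmul _ _ _ hi).trans_eq ?_)
        simp
      have h2 := Real.log_le_log (slNorm_pos A) h1
      rw [Real.log_mul (by exact_mod_cast NeZero.ne d) (norm_slVec_pos A _).ne'] at h2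
      rw [abs_of_nonneg ht, ← mul_add]
      exact mul_le_mul_of_nonneg_left h2 ht
    · refine ⟨0, ?_⟩
      have h1 := mul_le_mul_of_nonpos_left (log_norm_slVec_le A (basisSph 0)) ht.le
      have h2 : 0 ≤ |t| * Real.log d := by positivity
      linarith
  calc Real.exp (t * (Real.log (slNorm A) - c))
      ≤ Real.exp (|t| * Real.log d) * Real.exp
        (t * (Real.log ‖slVec A (basisSph i : EuclideanSpace ℝ (Fin d))‖ - c)) := by
        rw [← Real.exp_add]
        apply Real.exp_le_exp.2
        linarith
    _ ≤ _ := by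
        gcongr
        exact Finset.single_le_sum (f := fun i : Fin d => Real.exp
          (t * (Real.log ‖slVec A (basisSph i : EuclideanSpace ℝ (Fin d))‖ - c)))
          (fun i _ => (Real.exp_pos _).le) (Finset.mem_univ i)

/-- Exponential moments of the growth of the norm and of all directions, with the same
centering. -/
theorem exists_moment {d : ℕ} [NeZero d] {K : Set (ProbabilityMeasure (SL d))}
    (hK : IsCompact K) (hsp : ∀ μ ∈ K, SpacesCondition μ) {g D : ℝ} (hg : 0 < g) (hD : 1 ≤ D)
    (h : ExpMoment K g D) {ε : ℝ} (hε : 0 < ε) :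
    ∃ s : ℝ, 0 < s ∧ ∃ M : ℝ, ∀ n : ℕ,
      ∀ μ : ℕ → ProbabilityMeasure (SL d), (∀ i, μ i ∈ K) → ∃ c : ℝ, ∀ t : ℝ, |t| = s →
        (∀ x : Sph d, ∫⁻ A, ENNReal.ofReal (Real.exp
          (t * (Real.log ‖slVec A (x : EuclideanSpace ℝ (Fin d))‖ - c))) ∂law μ n ≤
            ENNReal.ofReal (Real.exp (M + s * (2 * ε * n)))) ∧
        ∫⁻ A, ENNReal.ofReal (Real.exp (t * (Real.log (slNorm A) - c))) ∂law μ n ≤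
            ENNReal.ofReal (Real.exp (M + s * (2 * ε * n))) := by
  obtain ⟨s, hs, M, hM, hvec⟩ := exists_vector_moment hK hsp hg hD h hε
  have hM0 : 0 < M := one_pos.trans_le hM
  have hd : (1 : ℝ) ≤ d := by exact_mod_cast NeZero.one_le
  have hlogd : 0 ≤ Real.log d := Real.log_natCast_nonneg d
  refine ⟨s, hs, s * Real.log d + Real.log d + Real.log M, fun n μ hμ => ?_⟩
  obtain ⟨c, hc⟩ := hvec n μ hμ
  refine ⟨c, fun t ht => ⟨fun x => (hc x t ht).trans (ENNReal.ofReal_le_ofReal ?_), ?_⟩⟩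
  · rw [Real.exp_add, Real.exp_add, Real.exp_log hM0]
    gcongr
    exact le_mul_of_one_le_left hM0.le (Real.one_le_exp (by positivity))
  · have hX (i : Fin d) := (continuous_log_norm_slVec (basisSph i)).measurable
    calc _ ≤ ∫⁻ A, ENNReal.ofReal (Real.exp (s * Real.log d)) *
          ∑ i : Fin d, ENNReal.ofReal (Real.exp (t * (Real.log
            ‖slVec A (basisSph i : EuclideanSpace ℝ (Fin d))‖ - c))) ∂law μ n := by
          refine lintegral_mono fun A => ?_
          rw [← ENNReal.ofReal_sum_of_nonneg fun i _ => (Real.exp_pos _).le,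
            ← ENNReal.ofReal_mul (Real.exp_pos _).le, ← ht]
          exact ENNReal.ofReal_le_ofReal (exp_mul_log_slNorm_sub_le A t c)
      _ = ENNReal.ofReal (Real.exp (s * Real.log d)) * ∑ i : Fin d,
          ∫⁻ A, ENNReal.ofReal (Real.exp (t * (Real.log
            ‖slVec A (basisSph i : EuclideanSpace ℝ (Fin d))‖ - c))) ∂law μ n := by
          rw [lintegral_const_mul' _ _ ENNReal.ofReal_ne_top, lintegral_finsetSum]
          intro i _
          have := hX i
          fun_prop
      _ ≤ ENNReal.ofReal (Real.exp (s * Real.log d)) * ∑ i : Fin d,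
          ENNReal.ofReal (M * Real.exp (s * (2 * ε * n))) := by
          gcongr with i
          exact hc (basisSph i) t ht
      _ = _ := by
          rw [Finset.sum_const, Finset.card_univ, Fintype.card_fin, nsmul_eq_mul,
            ← ENNReal.ofReal_natCast, ← ENNReal.ofReal_mul (by positivity),
            ← ENNReal.ofReal_mul (Real.exp_pos _).le, Real.exp_add, Real.exp_add, Real.exp_add,
            Real.exp_log hM0, Real.exp_log (by linarith)]
          congr 1
          ring

/-- Deviation estimate from exponential moments of a variable and of the one defining the
centering. -/
theorem measure_lt_abs_sub_integral_le {Ω : Type*} [MeasurableSpace Ω] {P : Measure Ω}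
    [IsProbabilityMeasure P] {Y Z : Ω → ℝ} (hY : Measurable Y) (hZ : Measurable Z)
    (hZi : Integrable Z P) {s c a b : ℝ} (hs : 0 < s)
    (hYexp : ∀ t, |t| = s → ∫⁻ ω, ENNReal.ofReal (Real.exp (t * (Y ω - c))) ∂P ≤
      ENNReal.ofReal (Real.exp (a + s * (2 * b))))
    (hZexp : ∀ t, |t| = s → ∫⁻ ω, ENNReal.ofReal (Real.exp (t * (Z ω - c))) ∂P ≤
      ENNReal.ofReal (Real.exp (a + s * (2 * b)))) :
    P {ω | 6 * b < |Y ω - ∫ ω, Z ω ∂P|} ≤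
      ENNReal.ofReal (2 * Real.exp (2 * a - 2 * (s * b))) := by
  have hmean : |∫ ω, Z ω ∂P - c| ≤ a / s + 2 * b := by
    have h1 := mul_integral_sub_le hZi hZ (hZexp s (abs_of_pos hs))
    have h2 := mul_integral_sub_le hZi hZ (hZexp (-s) (by rw [abs_neg, abs_of_pos hs]))
    have h3 : s * (a / s + 2 * b) = a + s * (2 * b) := by field_simp
    rw [abs_le]
    constructor
    · refine le_of_mul_le_mul_left ?_ hs
      linarith
    · refine le_of_mul_le_mul_left ?_ hs
      linarith
  have hsub : {ω | 6 * b < |Y ω - ∫ ω, Z ω ∂P|} ⊆ {ω | 4 * b - a / s < |Y ω - c|} := by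
    intro ω hω
    have h1 : 6 * b < |Y ω - ∫ ω, Z ω ∂P| := hω
    have h2 := abs_sub_le (Y ω) c (∫ ω, Z ω ∂P)
    rw [abs_sub_comm c] at h2
    change 4 * b - a / s < |Y ω - c|
    linarith
  refine (measure_mono hsub).trans ((measure_lt_abs_sub_le hY hs hYexp).trans_eq ?_)
  congr 3
  field_simp
  ring

/-- **Large deviations for non-stationary products** (Theorem 1.3).
For every `ε > 0` there are `δ > 0` and `N`, uniform over the choices of measures from `K`
and over unit vectors `v₀`, such that for `n ≥ N` the probability that `log ‖Tₙ‖`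
(resp. `log |Tₙ v₀|`) deviates from `Lₙ` by more than `ε n` is at most `e^{-δ n}`. -/
theorem nonstationary_large_deviations
    (d : ℕ) (hd : 0 < d)
    (K : Set (ProbabilityMeasure (SL d))) (hK : IsCompact K)
    (γ C : ℝ) (hγ : 0 < γ)
    (hmom : ∀ μ ∈ K, FiniteMomentCondition γ C μ)
    (hmeas : ∀ μ ∈ K, MeasuresCondition μ)
    (hsp : ∀ μ ∈ K, SpacesCondition μ) :
    ∀ ε : ℝ, 0 < ε → ∃ δ : ℝ, 0 < δ ∧ ∃ N : ℕ, ∀ n : ℕ, N ≤ n →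
      ∀ (μ : ℕ → ProbabilityMeasure (SL d)), (∀ i, μ i ∈ K) →
        ∀ ℙ : Measure (ℕ → SL d), IsProductMeasure μ ℙ →
          ℙ {ω | ε * n < |Real.log (slNorm (T ω n)) - L ℙ n|} <
              ENNReal.ofReal (Real.exp (-δ * n)) ∧
            ∀ v₀ : EuclideanSpace ℝ (Fin d), ‖v₀‖ = 1 →
              ℙ {ω | ε * n < |Real.log ‖slVec (T ω n) v₀‖ - L ℙ n|} <
                ENNReal.ofReal (Real.exp (-δ * n)) := by
  intro ε hε
  have : NeZero d := ⟨hd.ne'⟩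
  obtain ⟨g, hg, D, hD, hexp⟩ := exists_lintegral_exp_logSize_le hγ hmom
  have hD0 : 0 < D := one_pos.trans_le hD
  obtain ⟨s, hs, M, hM⟩ := exists_moment hK hsp hg hD hexp (ε := ε / 6) (by positivity)
  obtain ⟨N, hN⟩ := exists_nat_gt ((Real.log 2 + 2 * M) / (s * (ε / 6)))
  refine ⟨s * (ε / 6), by positivity, N, fun n hn μ hμ ℙ hℙ => ?_⟩
  have hNn : Real.log 2 + 2 * M < n * (s * (ε / 6)) :=
    (div_lt_iff₀ (by positivity)).1 (hN.trans_le (by exact_mod_cast hn))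
  have hlt : ENNReal.ofReal (2 * Real.exp (2 * M - 2 * (s * (ε / 6 * n)))) <
      ENNReal.ofReal (Real.exp (-(s * (ε / 6)) * n)) := by
    rw [ENNReal.ofReal_lt_ofReal_iff (Real.exp_pos _)]
    nth_rewrite 1 [← Real.exp_log two_pos]
    rw [← Real.exp_add]
    apply Real.exp_lt_exp.2
    linarith
  have hZc := continuous_log_slNorm (d := d)
  have hZ := hZc.measurable
  have hL : L ℙ n = ∫ A, Real.log (slNorm A) ∂law μ n := by
    rw [← hℙ.map_T n, integral_map (measurable_T n).aemeasurable hZ.aestronglyMeasurable]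
    rfl
  have hZi : Integrable (fun A : SL d => Real.log (slNorm A)) (law μ n) :=
    integrable_of_abs_le_of_lintegral_exp_le hg hZ (continuous_logSize (d := d)).measurable
      abs_log_slNorm_le (ExpMoment.lintegral_law_le hexp hg.le hD0.le hμ n)
  obtain ⟨c, hc⟩ := hM n μ hμ
  have key (Y : SL d → ℝ) (hY : Measurable Y) (hYexp : ∀ t, |t| = s →
      ∫⁻ A, ENNReal.ofReal (Real.exp (t * (Y A - c))) ∂law μ n ≤
        ENNReal.ofReal (Real.exp (M + s * (2 * (ε / 6) * n)))) :
      ℙ {ω | ε * n < |Y (T ω n) - L ℙ n|} < ENNReal.ofReal (Real.exp (-(s * (ε / 6)) * n)) := by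
    have h1 := measure_lt_abs_sub_integral_le (b := ε / 6 * n) (a := M) hY hZ hZi hs
      (by simpa only [mul_assoc] using hYexp)
      (fun t ht => by simpa only [mul_assoc] using (hc t ht).2)
    rw [show 6 * (ε / 6 * n) = ε * n by ring, ← hL] at h1
    have hS : MeasurableSet {A : SL d | ε * n < |Y A - L ℙ n|} :=
      measurableSet_lt measurable_const (by fun_prop)
    nth_rewrite 1 [← hℙ.map_T n] at h1
    rw [Measure.map_apply (measurable_T n) hS] at h1
    exact h1.trans_lt hlt
  exact ⟨key _ hZ fun t ht => (hc t ht).2, fun v₀ hv₀ =>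
    key _ (continuous_log_norm_slVec ⟨v₀, mem_sphere_zero_iff_norm.2 hv₀⟩).measurable
      fun t ht => (hc t ht).1 ⟨v₀, mem_sphere_zero_iff_norm.2 hv₀⟩⟩
end
end

section
/- Atoms dissolving (uniform part). Let K_X be a compact set of Borel probability measures on Homeo(X), and assume that for every μ ∈ K_X there is no finite set with deterministic image. Then for every ε > 0 there exists n such that for every Borel probability measure ν on X and every choice of μ₁, …, μₙ ∈ K_X one has 𝔐𝔞𝔵(μₙ * ⋯ * μ₁ * ν) < ε. In particular, for every Borel probability measure ν on X and every sequence μ₁, μ₂, … ∈ K_X one has lim_{n→∞} 𝔐𝔞𝔵(μₙ * ⋯ * μ₁ * ν) = 0. -/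
open MeasureTheory
open scoped ENNReal

noncomputable section

/-- Topology of uniform convergence (= compact-open topology) on `Homeo(X)`. -/
instance homeoTopologicalSpace {X : Type*} [TopologicalSpace X] :
    TopologicalSpace (X ≃ₜ X) :=
  TopologicalSpace.induced (fun f : X ≃ₜ X => (f : C(X, X))) inferInstance

instance homeoMeasurableSpace {X : Type*} [TopologicalSpace X] :
    MeasurableSpace (X ≃ₜ X) := borel _

instance homeoBorelSpace {X : Type*} [TopologicalSpace X] :
    BorelSpace (X ≃ₜ X) := ⟨rfl⟩

/-- `μ * ν = ∫ f_* ν dμ(f)`: the law of `f x` with `f ∼ μ`, `x ∼ ν` independent. -/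
def mconv {X : Type*} [TopologicalSpace X] [MeasurableSpace X]
    (μ : Measure (X ≃ₜ X)) (ν : Measure X) : Measure X :=
  μ.bind fun f => ν.map f

/-- The maximal weight of an atom of a measure. -/
def maxAtom {X : Type*} [MeasurableSpace X] (ν : Measure X) : ℝ≥0∞ :=
  ⨆ x : X, ν {x}

/-- Iterated convolution `μₙ * ⋯ * μ₁ * ν`. -/
def iterConv {X : Type*} [TopologicalSpace X] [MeasurableSpace X]
    (μ : ℕ → ProbabilityMeasure (X ≃ₜ X)) (ν : Measure X) : ℕ → Measure X
  | 0 => ν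
  | n + 1 => mconv (μ n : Measure (X ≃ₜ X)) (iterConv μ ν n)

open scoped Classical in
/-- Relative entropy (Kullback–Leibler divergence) `h(ν | ν')`. -/
def relEnt {X : Type*} [MeasurableSpace X] (ν ν' : Measure X) : ℝ≥0∞ :=
  if ν ≪ ν' ∧ Integrable (fun x => Real.log (ν.rnDeriv ν' x).toReal) ν
  then ENNReal.ofReal (∫ x, Real.log (ν.rnDeriv ν' x).toReal ∂ν)
  else ⊤

/-- The Furstenberg entropy `Φ_μ(ν) = ∫ h(f_*ν | μ*ν) dμ(f)`. -/
def furstEnt {X : Type*} [TopologicalSpace X] [MeasurableSpace X]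
    (μ : Measure (X ≃ₜ X)) (ν : Measure X) : ℝ≥0∞ :=
  ∫⁻ f, relEnt (ν.map f) (mconv μ ν) ∂μ

/-- The conditional version `Φ_μ(ν | ν') = ∫ h(f_*ν | ν') dμ(f)`. -/
def furstEntCond {X : Type*} [TopologicalSpace X] [MeasurableSpace X]
    (μ : Measure (X ≃ₜ X)) (ν ν' : Measure X) : ℝ≥0∞ :=
  ∫⁻ f, relEnt (ν.map f) ν' ∂μ

/-- The law of `f ∘ g`, where `f ∼ μ'` and `g ∼ μ` independently. -/
def hconv {X : Type*} [TopologicalSpace X] (μ' μ : Measure (X ≃ₜ X)) :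
    Measure (X ≃ₜ X) :=
  (μ'.prod μ).map fun p => p.2.trans p.1

/-- Total variation distance between two (finite Borel) measures. -/
def tvDist {X : Type*} [MeasurableSpace X] (α β : Measure X) : ℝ≥0∞ :=
  (⨆ (s : Set X) (_ : MeasurableSet s), (α s - β s)) +
    (⨆ (s : Set X) (_ : MeasurableSet s), (β s - α s))

/-- Sum of squares of the weights of atoms. -/
def sqAtomMass {X : Type*} [MeasurableSpace X] (ν : Measure X) : ℝ≥0∞ :=
  ∑' x : X, (ν {x}) ^ 2

/-- The measure `Σ_x ν({x})² δ_x`. -/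
def sqAtomMeasure {X : Type*} [MeasurableSpace X] (ν : Measure X) : Measure X :=
  Measure.sum fun x : X => (ν {x}) ^ 2 • Measure.dirac x



namespace AtomsDissolving

open Set Filter Topology

section Homeo

variable {X : Type*} [MetricSpace X] [CompactSpace X]

theorem continuous_homeo_eval : Continuous fun p : (X ≃ₜ X) × X => p.1 p.2 := by
  have hc : Continuous fun f : X ≃ₜ X => (f : C(X, X)) := continuous_induced_dom
  exact (hc.comp continuous_fst).eval continuous_snd

instance : TopologicalSpace.PseudoMetrizableSpace (X ≃ₜ X) :=
  Topology.IsInducing.pseudoMetrizableSpace (f := fun f : X ≃ₜ X => (f : C(X, X))) ⟨rfl⟩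

/-- The triples `(f, x, y)` for which `f` maps the set of entries of `x` onto that of `y`. -/
def imageEq (X : Type*) [TopologicalSpace X] (N : ℕ) :
    Set ((X ≃ₜ X) × ((Fin N → X) × (Fin N → X))) :=
  {p | p.1 '' range p.2.1 = range p.2.2}

theorem isClosed_imageEq (N : ℕ) : IsClosed (imageEq X N) := by
  have key (i j : Fin N) : IsClosed {p : (X ≃ₜ X) × ((Fin N → X) × (Fin N → X)) |
      p.1 (p.2.1 i) = p.2.2 j} := by
    refine isClosed_eq (continuous_homeo_eval.comp (continuous_fst.prodMk ?_)) ?_ <;> fun_prop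
  have : imageEq X N = (⋂ i, ⋃ j, {p | p.1 (p.2.1 i) = p.2.2 j}) ∩
      ⋂ j, ⋃ i, {p | p.1 (p.2.1 i) = p.2.2 j} := by
    ext ⟨f, x, y⟩
    simp only [imageEq, mem_ofPred_eq, mem_inter_iff, mem_iInter, mem_iUnion]
    rw [← range_comp, Subset.antisymm_iff, range_subset_iff, range_subset_iff]
    simp only [mem_range, Function.comp_apply, eq_comm]
  rw [this]
  exact (isClosed_iInter fun i => isClosed_iUnion_of_finite fun j => key i j).inter
    (isClosed_iInter fun j => isClosed_iUnion_of_finite fun i => key i j)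

end Homeo

/-- The mass of the fibre of an open set is lower semicontinuous in the measure and the point. -/
theorem lowerSemicontinuous_measure_fibre {G Z : Type*} [TopologicalSpace G]
    [HasOuterApproxClosed G] [MeasurableSpace G] [OpensMeasurableSpace G] [PseudoMetricSpace Z]
    {O : Set (G × Z)} (hO : IsOpen O) :
    LowerSemicontinuous fun q : ProbabilityMeasure G × Z =>
      (q.1 : Measure G) {g | (g, q.2) ∈ O} := by
  rintro ⟨μ, z⟩ c hc
  let W : ℕ → Set G := fun m => interior {g | ∀ z' ∈ Metric.ball z (1 / ((m : ℝ) + 1)), (g, z') ∈ O}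
  have hW : {g | (g, z) ∈ O} ⊆ ⋃ m, W m := by
    intro g hg
    obtain ⟨u, hu, v, hv, huv⟩ := mem_nhds_prod_iff.1 (hO.mem_nhds hg)
    obtain ⟨r, hr, hrv⟩ := Metric.mem_nhds_iff.1 hv
    obtain ⟨m, hm⟩ := exists_nat_one_div_lt hr
    refine mem_iUnion.2 ⟨m, mem_interior_iff_mem_nhds.2 (mem_of_superset hu ?_)⟩
    exact fun g' hg' z' hz' => huv ⟨hg', hrv (Metric.ball_subset_ball hm.le hz')⟩
  have hmono : Monotone W := by
    intro m m' hmm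
    refine interior_mono fun g hg z' hz' => hg z' (Metric.ball_subset_ball ?_ hz')
    gcongr
  have hsup := hc.trans_le (measure_mono hW)
  rw [hmono.measure_iUnion, lt_iSup_iff] at hsup
  obtain ⟨m, hm⟩ := hsup
  have hlim := ProbabilityMeasure.le_liminf_measure_open_of_tendsto
    (tendsto_id (x := 𝓝 μ)) (isOpen_interior : IsOpen (W m))
  have h1 : ∀ᶠ μ' : ProbabilityMeasure G in 𝓝 μ, c < (μ' : Measure G) (W m) :=
    eventually_lt_of_lt_liminf (hm.trans_le hlim)
  have h2 : ∀ᶠ z' in 𝓝 z, z' ∈ Metric.ball z (1 / ((m : ℝ) + 1)) :=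
    Metric.ball_mem_nhds z (by positivity)
  rw [nhds_prod_eq]
  filter_upwards [h1.prod_mk h2] with q hq
  exact hq.1.trans_le (measure_mono fun g hg => interior_subset hg q.2 hq.2)

/-- Compactness: the probability of not sending one `N`-point set onto another is bounded below. -/
theorem exists_uniform_nondeterminism {X : Type*} [MetricSpace X] [CompactSpace X]
    {K : Set (ProbabilityMeasure (X ≃ₜ X))} (hK : IsCompact K)
    (h : ∀ μ ∈ K, ¬ ∃ F F' : Set X, F.Finite ∧ F.Nonempty ∧
      ∀ᵐ (f : X ≃ₜ X) ∂(μ : Measure (X ≃ₜ X)), f '' F = F') (N : ℕ) [NeZero N] :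
    ∃ κ : ℝ≥0∞, 0 < κ ∧ ∀ μ ∈ K, ∀ x y : Fin N → X,
      κ ≤ (μ : Measure (X ≃ₜ X)) {f | f '' range x ≠ range y} := by
  have hlsc := lowerSemicontinuous_measure_fibre (isClosed_imageEq (X := X) N).isOpen_compl
  rcases (K ×ˢ (univ : Set ((Fin N → X) × (Fin N → X)))).eq_empty_or_nonempty with he | hne
  · refine ⟨1, one_pos, fun μ hμ x y => ?_⟩
    have : (μ, x, y) ∈ K ×ˢ (univ : Set ((Fin N → X) × (Fin N → X))) := ⟨hμ, mem_univ _⟩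
    simp [he] at this
  · obtain ⟨⟨μ, x, y⟩, hq, hmin⟩ := LowerSemicontinuousOn.exists_isMinOn hne
      (hK.prod isCompact_univ) (hlsc.lowerSemicontinuousOn _)
    refine ⟨_, pos_iff_ne_zero.2 fun h0 => h μ hq.1
      ⟨range x, range y, finite_range x, range_nonempty x, ?_⟩, fun μ' hμ' x' y' =>
        hmin (show (μ', x', y') ∈ K ×ˢ univ from ⟨hμ', mem_univ _⟩)⟩
    rw [ae_iff]
    exact h0

theorem exists_range_eq {X : Type*} {F : Set X} (hF : F.Finite) (hne : F.Nonempty) {N : ℕ}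
    (hN : F.ncard ≤ N) : ∃ x : Fin N → X, range x = F := by
  have := hF.fintype
  have := hne.to_subtype
  obtain ⟨e⟩ : Nonempty (F ↪ Fin N) := Function.Embedding.nonempty_of_card_le (by
    rwa [Fintype.card_fin, ← Nat.card_eq_fintype_card, Nat.card_coe_set_eq])
  refine ⟨fun i => (Function.invFun e i : F), ?_⟩
  change range (Subtype.val ∘ Function.invFun e) = F
  rw [(Function.invFun_surjective e.injective).range_comp, Subtype.range_coe]

theorem exists_eq_succ_of_antitone {X : Type*} {A : ℕ → Set X} (hA : Antitone A) {N : ℕ}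
    (hfin : (A 0).Finite) (hN : (A 0).ncard ≤ N) : ∃ i ≤ N, A (i + 1) = A i := by
  by_contra! hne
  have hcard (i : ℕ) (hi : i ≤ N + 1) : (A i).ncard + i ≤ N := by
    induction i with
    | zero => simpa using hN
    | succ i ih =>
      have := ncard_lt_ncard ((hA (Nat.le_add_right i 1)).ssubset_of_ne (hne i (by omega)))
        (hfin.subset (hA (Nat.zero_le i)))
      have := ih (by omega)
      omega
  have := hcard (N + 1) le_rfl
  omega

section Atoms

variable {X : Type*} [MeasurableSpace X] [MeasurableSingletonClass X]
  (ν : Measure X) [IsProbabilityMeasure ν]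

theorem tsum_singleton_le_one : ∑' x, ν {x} ≤ 1 :=
  (tsum_meas_le_meas_iUnion_of_disjoint ν (fun x => measurableSet_singleton x)
    (fun x y hxy => by simpa using hxy)).trans prob_le_one

theorem sqAtomMass_le_one : sqAtomMass ν ≤ 1 := by
  refine le_trans (ENNReal.tsum_le_tsum fun x => ?_) (tsum_singleton_le_one ν)
  rw [sq]
  exact mul_le_of_le_one_left' prob_le_one

theorem exists_le_singleton {e : ℝ≥0∞} (he : e ≠ 0) (h : e ≤ sqAtomMass ν) :
    ∃ x, e / 2 ≤ ν {x} := by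
  by_contra! hlt
  have hle : sqAtomMass ν ≤ e / 2 := calc
    sqAtomMass ν ≤ ∑' x, e / 2 * ν {x} := ENNReal.tsum_le_tsum fun x => by
        rw [sq]; gcongr; exact (hlt x).le
    _ = e / 2 * ∑' x, ν {x} := ENNReal.tsum_mul_left
    _ ≤ e / 2 * 1 := by gcongr; exact tsum_singleton_le_one ν
    _ = e / 2 := mul_one _
  have htop : e ≠ ⊤ := ne_top_of_le_ne_top ENNReal.one_ne_top (h.trans (sqAtomMass_le_one ν))
  exact absurd (h.trans hle) (not_le.2 (ENNReal.half_lt_self he htop))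

theorem finite_ncard_heavy_le {a : ℝ≥0∞} (ha : a ≠ 0) {N : ℕ} (hN : 1 / a ≤ N) :
    {x | a ≤ ν {x}}.Finite ∧ {x | a ≤ ν {x}}.ncard ≤ N := by
  obtain ⟨hf, hc⟩ := ENNReal.finset_card_const_le_le_of_tsum_le ENNReal.one_ne_top
    (tsum_singleton_le_one ν) ha
  refine ⟨hf, ?_⟩
  rw [ncard_eq_toFinset_card _ hf]
  exact_mod_cast hc.trans hN

end Atoms

theorem two_mul_add_sq_le {a b d : ℝ≥0∞} (h : a + d ≤ b ∨ b + d ≤ a) :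
    2 * (a * b) + d ^ 2 ≤ a ^ 2 + b ^ 2 := by
  wlog hab : a + d ≤ b generalizing a b
  · have := this h.symm (h.resolve_left hab)
    rwa [mul_comm b, add_comm (b ^ 2)] at this
  obtain ⟨c, rfl⟩ := exists_add_of_le hab
  calc 2 * (a * (a + d + c)) + d ^ 2
      ≤ 2 * (a * (a + d + c)) + d ^ 2 + (c ^ 2 + 2 * d * c) := le_self_add
    _ = a ^ 2 + (a + d + c) ^ 2 := by ring

section Convolution

theorem map_homeo_singleton {X : Type*} [TopologicalSpace X] [T1Space X] [MeasurableSpace X]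
    [BorelSpace X] (ν : Measure X) (f : X ≃ₜ X) (x : X) : ν.map f {x} = ν {f.symm x} := by
  rw [Measure.map_apply f.continuous.measurable (measurableSet_singleton x)]
  congr 1
  ext y
  simp [Homeomorph.eq_symm_apply]

variable {X : Type*} [MetricSpace X] [CompactSpace X] [MeasurableSpace X] [BorelSpace X]
  (μ : Measure (X ≃ₜ X)) (ν : Measure X) [IsProbabilityMeasure ν]

theorem measurable_map_homeo : Measurable fun f : X ≃ₜ X => ν.map f := by
  refine Measure.measurable_of_measurable_coe _ fun s hs => ?_
  have hm : Measurable fun p : (X ≃ₜ X) × X => p.1 p.2 := continuous_homeo_eval.measurable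
  have hmap (f : X ≃ₜ X) : ν.map f s = ν (f ⁻¹' s) :=
    Measure.map_apply f.continuous.measurable hs
  simp_rw [hmap]
  exact measurable_measure_prodMk_left (hm hs)

theorem mconv_apply {s : Set X} (hs : MeasurableSet s) :
    mconv μ ν s = ∫⁻ f, ν.map f s ∂μ :=
  Measure.bind_apply hs (measurable_map_homeo ν).aemeasurable

instance [IsProbabilityMeasure μ] : IsProbabilityMeasure (mconv μ ν) := by
  refine ⟨?_⟩
  rw [mconv_apply μ ν MeasurableSet.univ]
  have (f : X ≃ₜ X) : ν.map f univ = 1 := by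
    rw [Measure.map_apply f.continuous.measurable MeasurableSet.univ, preimage_univ, measure_univ]
  simp [this]

theorem measurable_singleton_symm (x : X) : Measurable fun f : X ≃ₜ X => ν {f.symm x} := by
  simp_rw [← map_homeo_singleton]
  exact (Measure.measurable_coe (measurableSet_singleton x)).comp (measurable_map_homeo ν)

theorem mconv_singleton (x : X) : mconv μ ν {x} = ∫⁻ f, ν {f.symm x} ∂μ := by
  rw [mconv_apply μ ν (measurableSet_singleton x)]
  simp_rw [map_homeo_singleton]

/-- Strict convexity of the `ℓ²` norm, quantitatively: the loss of `sqAtomMass` under convolution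
controls how much the atoms of `f_* ν` deviate from those of `μ * ν`. -/
theorem sqAtomMass_mconv_add_le [IsProbabilityMeasure μ] (d : ℝ≥0∞) :
    sqAtomMass (mconv μ ν) + d ^ 2 * μ {f | ∃ x, mconv μ ν {x} + d ≤ ν {f.symm x} ∨
      ν {f.symm x} + d ≤ mconv μ ν {x}} ≤ sqAtomMass ν := by
  set w' : X → ℝ≥0∞ := fun x => mconv μ ν {x} with hw'
  have hT : (Function.support w').Countable := Summable.countable_support_ennreal
    (ne_top_of_le_ne_top ENNReal.one_ne_top (tsum_singleton_le_one (mconv μ ν)))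
  have := hT.to_subtype
  let c : (X ≃ₜ X) → ℝ≥0∞ := fun f => ∑' x, w' x * ν {f.symm x}
  have hc (f : X ≃ₜ X) : c f = ∑' x : Function.support w', w' x * ν {f.symm x} :=
    (tsum_subtype_eq_of_support_subset (f := fun x => w' x * ν {f.symm x})
      (Function.support_mul_subset_left _ _)).symm
  have hterm (x : X) : Measurable fun f : X ≃ₜ X => w' x * ν {f.symm x} :=
    (measurable_singleton_symm ν x).const_mul _
  have hcm : Measurable c := by
    rw [funext hc]
    exact Measurable.tsum fun x => hterm x
  have hint : ∫⁻ f, c f ∂μ = sqAtomMass (mconv μ ν) := by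
    rw [lintegral_congr hc, lintegral_tsum fun x : Function.support w' => (hterm x).aemeasurable]
    simp_rw [lintegral_const_mul _ (measurable_singleton_symm ν _), ← mconv_singleton]
    rw [tsum_subtype_eq_of_support_subset (f := fun x => w' x * mconv μ ν {x})
      (Function.support_mul_subset_left _ _)]
    simp only [sqAtomMass, sq, hw']
  have hsymm (f : X ≃ₜ X) : ∑' x, ν {f.symm x} ^ 2 = sqAtomMass ν :=
    f.symm.toEquiv.tsum_eq fun x => ν {x} ^ 2
  let B : Set (X ≃ₜ X) :=
    {f | 2 * c f + d ^ 2 ≤ sqAtomMass (mconv μ ν) + sqAtomMass ν}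
  have hB : MeasurableSet B := measurableSet_le ((hcm.const_mul 2).add_const _) measurable_const
  have hpt (f : X ≃ₜ X) (x : X) : 2 * (w' x * ν {f.symm x}) ≤ w' x ^ 2 + ν {f.symm x} ^ 2 := by
    have := two_mul_add_sq_le (a := w' x) (b := ν {f.symm x}) (d := 0)
      (by simpa using le_total _ _)
    simpa using this
  have hsum (f : X ≃ₜ X) : ∑' x, (w' x ^ 2 + ν {f.symm x} ^ 2) =
      sqAtomMass (mconv μ ν) + sqAtomMass ν := by
    rw [ENNReal.tsum_add, hsymm]; rfl
  have hsub : {f : X ≃ₜ X | ∃ x, mconv μ ν {x} + d ≤ ν {f.symm x} ∨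
      ν {f.symm x} + d ≤ mconv μ ν {x}} ⊆ B := by
    classical
    rintro f ⟨x₀, hx₀⟩
    change 2 * c f + d ^ 2 ≤ _
    rw [← hsum f, ← ENNReal.tsum_mul_left, ← tsum_ite_eq x₀ (fun _ => d ^ 2), ← ENNReal.tsum_add]
    refine ENNReal.tsum_le_tsum fun x => ?_
    split_ifs with hx
    · subst hx
      exact two_mul_add_sq_le hx₀
    · simpa using hpt f x
  have hall (f : X ≃ₜ X) : 2 * c f + B.indicator (fun _ => d ^ 2) f ≤
      sqAtomMass (mconv μ ν) + sqAtomMass ν := by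
    by_cases hf : f ∈ B
    · rw [indicator_of_mem hf]
      exact hf
    · rw [indicator_of_notMem hf, add_zero, ← hsum f, ← ENNReal.tsum_mul_left]
      exact ENNReal.tsum_le_tsum (hpt f)
  have hI := lintegral_mono (μ := μ) hall
  rw [lintegral_add_left (hcm.const_mul 2), lintegral_const_mul _ hcm, hint,
    lintegral_indicator_const hB, lintegral_const, measure_univ, mul_one, two_mul, add_assoc,
    ENNReal.add_le_add_iff_left
      (ne_top_of_le_ne_top ENNReal.one_ne_top (sqAtomMass_le_one (mconv μ ν)))] at hI
  refine le_trans ?_ hI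
  gcongr

theorem sqAtomMass_mconv_le [IsProbabilityMeasure μ] : sqAtomMass (mconv μ ν) ≤ sqAtomMass ν := by
  simpa using sqAtomMass_mconv_add_le μ ν 0

instance isProbabilityMeasure_iterConv (μseq : ℕ → ProbabilityMeasure (X ≃ₜ X)) (n : ℕ) :
    IsProbabilityMeasure (iterConv μseq ν n) := by
  induction n with
  | zero => assumption
  | succ n ih => exact inferInstanceAs (IsProbabilityMeasure (mconv _ (iterConv μseq ν n)))

end Convolution

/-- If `ν` has no atom with weight in `[s, s + 2 d)`, then a map `f` for which the atoms of `f_* ν`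
are `d`-close to those of `ν'` sends the atoms above the gap to the heavy atoms of `ν'`. -/
theorem image_heavy_eq {X : Type*} [TopologicalSpace X] [MeasurableSpace X] {ν ν' : Measure X}
    {s d : ℝ≥0∞} (hd : d ≠ ⊤) (hgap : ∀ x, s ≤ ν {x} → s + d + d ≤ ν {x}) {f : X ≃ₜ X}
    (hf : ∀ x, ν {f.symm x} < ν' {x} + d ∧ ν' {x} < ν {f.symm x} + d) :
    f '' {x | s + d + d ≤ ν {x}} = {x | s + d ≤ ν' {x}} := by
  ext x
  rw [f.image_eq_preimage_symm]
  simp only [mem_preimage, mem_ofPred_eq]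
  constructor
  · exact fun hx => ((ENNReal.add_lt_add_iff_right hd).1 (hx.trans_lt (hf x).1)).le
  · exact fun hx => hgap _ ((ENNReal.add_lt_add_iff_right hd).1 (hx.trans_lt (hf x).2)).le

theorem exists_uniform_decrease {X : Type*} [MetricSpace X] [CompactSpace X] [MeasurableSpace X]
    [BorelSpace X] {K : Set (ProbabilityMeasure (X ≃ₜ X))} (hK : IsCompact K)
    (h : ∀ μ ∈ K, ¬ ∃ F F' : Set X, F.Finite ∧ F.Nonempty ∧
      ∀ᵐ (f : X ≃ₜ X) ∂(μ : Measure (X ≃ₜ X)), f '' F = F')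
    {e : ℝ≥0∞} (he : e ≠ 0) (he' : e ≠ ⊤) :
    ∃ η : ℝ≥0∞, η ≠ 0 ∧ ∀ μ ∈ K, ∀ (ν : Measure X) [IsProbabilityMeasure ν],
      e ≤ sqAtomMass ν → sqAtomMass (mconv (μ : Measure (X ≃ₜ X)) ν) + η ≤ sqAtomMass ν := by
  set a : ℝ≥0∞ := e / 2 / 2 with ha
  have ha0 : a ≠ 0 := by simp [ha, he]
  have hatop : a ≠ ⊤ := by simp [ha, ENNReal.div_eq_top, he, he']
  obtain ⟨N, hN⟩ := ENNReal.exists_nat_gt (r := 1 / a) (by simp [ha0])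
  have : NeZero N := ⟨by rintro rfl; simp at hN⟩
  obtain ⟨κ, hκ, hκK⟩ := exists_uniform_nondeterminism hK h N
  set d : ℝ≥0∞ := a / (2 * (N + 1)) with hd
  have hd0 : d ≠ 0 := by
    simp [hd, ENNReal.div_eq_zero_iff, ha0, ENNReal.mul_eq_top]
  have hdtop : d ≠ ⊤ := by simp [hd, ENNReal.div_eq_top, hatop]
  refine ⟨d ^ 2 * κ, mul_ne_zero (pow_ne_zero 2 hd0) hκ.ne', fun μ hμ ν _ hν => ?_⟩
  refine le_trans ?_ (sqAtomMass_mconv_add_le (μ : Measure (X ≃ₜ X)) ν d)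
  gcongr
  let A : ℕ → Set X := fun i => {x | a + i * (2 * d) ≤ ν {x}}
  have hA : Antitone A := by
    intro i j hij x (hx : a + j * (2 * d) ≤ ν {x})
    refine le_trans (b := a + j * (2 * d)) ?_ hx
    gcongr
  obtain ⟨hfin, hcard⟩ := finite_ncard_heavy_le ν ha0 hN.le
  have hA0 : A 0 = {x | a ≤ ν {x}} := by simp [A]
  obtain ⟨i, hiN, hi⟩ := exists_eq_succ_of_antitone hA (N := N) (by rwa [hA0]) (by rwa [hA0])
  set s : ℝ≥0∞ := a + i * (2 * d) with hs
  have has : a ≤ s := le_self_add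
  have hsucc : a + ((i + 1 : ℕ) : ℝ≥0∞) * (2 * d) = s + d + d := by
    rw [hs]; push_cast; ring
  have hAi : A (i + 1) = {x | s + d + d ≤ ν {x}} := by simp only [A, hsucc]
  have hgap (x : X) (hx : s ≤ ν {x}) : s + d + d ≤ ν {x} := by
    have : x ∈ A (i + 1) := hi ▸ hx
    rwa [hAi] at this
  have htop : s + d + d ≤ e / 2 := by
    rw [← hsucc]
    calc a + ((i + 1 : ℕ) : ℝ≥0∞) * (2 * d)
        ≤ a + ((N + 1 : ℕ) : ℝ≥0∞) * (2 * d) := by gcongr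
      _ = a + (2 * (N + 1)) * d := by push_cast; ring
      _ = a + a := by
        rw [hd, ENNReal.mul_div_cancel (by simp)
          (by simp [ENNReal.mul_eq_top])]
      _ = e / 2 := ENNReal.add_halves _
  have hFne : {x | s + d + d ≤ ν {x}}.Nonempty := by
    obtain ⟨x, hx⟩ := exists_le_singleton ν he hν
    exact ⟨x, htop.trans hx⟩
  have hsubF : {x | s + d + d ≤ ν {x}} ⊆ {x | a ≤ ν {x}} := fun x hx =>
    has.trans (le_self_add.trans (le_self_add.trans hx))
  obtain ⟨x, hx⟩ := exists_range_eq (hfin.subset hsubF) hFne ((ncard_le_ncard hsubF hfin).trans hcard)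
  obtain ⟨hfin', hcard'⟩ := finite_ncard_heavy_le (mconv (μ : Measure (X ≃ₜ X)) ν) ha0 hN.le
  have hsubF' : {x | s + d ≤ mconv (μ : Measure (X ≃ₜ X)) ν {x}} ⊆
      {x | a ≤ mconv (μ : Measure (X ≃ₜ X)) ν {x}} := fun x hx =>
    has.trans (le_self_add.trans hx)
  have hbad (f : X ≃ₜ X) (hf : f '' range x ≠ {x | s + d ≤ mconv (μ : Measure (X ≃ₜ X)) ν {x}}) :
      ∃ x, mconv (μ : Measure (X ≃ₜ X)) ν {x} + d ≤ ν {f.symm x} ∨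
        ν {f.symm x} + d ≤ mconv (μ : Measure (X ≃ₜ X)) ν {x} := by
    by_contra! hcon
    rw [hx] at hf
    exact hf (image_heavy_eq hdtop hgap hcon)
  rcases {x | s + d ≤ mconv (μ : Measure (X ≃ₜ X)) ν {x}}.eq_empty_or_nonempty with hF' | hF'
  · refine (hκK μ hμ x x).trans (measure_mono fun f _ => hbad f ?_)
    rw [hF', hx]
    exact (hFne.image f).ne_empty
  · obtain ⟨y, hy⟩ := exists_range_eq (hfin'.subset hsubF') hF'
      ((ncard_le_ncard hsubF' hfin').trans hcard')
    exact (hκK μ hμ x y).trans (measure_mono fun f hf => hbad f (hy ▸ hf))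

theorem exists_forall_sqAtomMass_lt {X : Type*} [MetricSpace X] [CompactSpace X]
    [MeasurableSpace X] [BorelSpace X] {K : Set (ProbabilityMeasure (X ≃ₜ X))} (hK : IsCompact K)
    (h : ∀ μ ∈ K, ¬ ∃ F F' : Set X, F.Finite ∧ F.Nonempty ∧
      ∀ᵐ (f : X ≃ₜ X) ∂(μ : Measure (X ≃ₜ X)), f '' F = F')
    {e : ℝ≥0∞} (he : e ≠ 0) (he' : e ≠ ⊤) :
    ∃ n₀ : ℕ, ∀ n ≥ n₀, ∀ (ν : Measure X) [IsProbabilityMeasure ν]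
      (μseq : ℕ → ProbabilityMeasure (X ≃ₜ X)), (∀ i, μseq i ∈ K) →
        sqAtomMass (iterConv μseq ν n) < e := by
  obtain ⟨η, hη, hdec⟩ := exists_uniform_decrease hK h he he'
  obtain ⟨n₀, hn₀⟩ := ENNReal.exists_nat_mul_gt hη ENNReal.one_ne_top
  refine ⟨n₀, fun n hn ν _ μseq hμ => lt_of_not_ge fun hge => ?_⟩
  have key (k : ℕ) (hk : e ≤ sqAtomMass (iterConv μseq ν k)) :
      sqAtomMass (iterConv μseq ν k) + k * η ≤ 1 := by
    induction k with
    | zero => simpa using sqAtomMass_le_one (iterConv μseq ν 0)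
    | succ k ih =>
      have hk' := hk.trans (sqAtomMass_mconv_le (μseq k : Measure (X ≃ₜ X)) (iterConv μseq ν k))
      have hstep := hdec (μseq k) (hμ k) (iterConv μseq ν k) hk'
      calc sqAtomMass (iterConv μseq ν (k + 1)) + ((k + 1 : ℕ) : ℝ≥0∞) * η
          = (sqAtomMass (iterConv μseq ν (k + 1)) + η) + k * η := by push_cast; ring
        _ ≤ sqAtomMass (iterConv μseq ν k) + k * η := by gcongr; exact hstep
        _ ≤ 1 := ih hk'
  have h1 : (n : ℝ≥0∞) * η ≤ 1 := le_add_self.trans (key n hge)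
  have h2 : (n₀ : ℝ≥0∞) * η ≤ n * η := by gcongr
  exact absurd (hn₀.trans_le (h2.trans h1)) (lt_irrefl _)

theorem maxAtom_le_of_sqAtomMass_le {X : Type*} [MeasurableSpace X] {ν : Measure X} {e : ℝ≥0∞}
    (h : sqAtomMass ν ≤ e ^ 2) : maxAtom ν ≤ e := by
  refine iSup_le fun x => ?_
  have : ν {x} ^ 2 ≤ e ^ 2 := (ENNReal.le_tsum x).trans h
  exact (ENNReal.pow_le_pow_left_iff two_ne_zero).1 this

theorem exists_forall_maxAtom_lt {X : Type*} [MetricSpace X] [CompactSpace X]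
    [MeasurableSpace X] [BorelSpace X] {K : Set (ProbabilityMeasure (X ≃ₜ X))} (hK : IsCompact K)
    (h : ∀ μ ∈ K, ¬ ∃ F F' : Set X, F.Finite ∧ F.Nonempty ∧
      ∀ᵐ (f : X ≃ₜ X) ∂(μ : Measure (X ≃ₜ X)), f '' F = F')
    {ε : ℝ≥0∞} (hε : ε ≠ 0) :
    ∃ n₀ : ℕ, ∀ n ≥ n₀, ∀ (ν : Measure X) [IsProbabilityMeasure ν]
      (μseq : ℕ → ProbabilityMeasure (X ≃ₜ X)), (∀ i, μseq i ∈ K) →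
        maxAtom (iterConv μseq ν n) < ε := by
  obtain ⟨r, hr0, hr⟩ := ENNReal.lt_iff_exists_nnreal_btwn.1 (pos_iff_ne_zero.2 hε)
  obtain ⟨n₀, hn₀⟩ := exists_forall_sqAtomMass_lt hK h (e := (r : ℝ≥0∞) ^ 2)
    (pow_ne_zero 2 hr0.ne') (by simp)
  exact ⟨n₀, fun n hn ν _ μseq hμ =>
    (maxAtom_le_of_sqAtomMass_le (hn₀ n hn ν μseq hμ).le).trans_lt hr⟩

end AtomsDissolving

/-- **Atoms dissolving, uniform part** (Theorem 1.8, first part).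
If no `μ ∈ K` admits a (nonempty) finite set with a deterministic image, then for every
`ε > 0` there is `n` such that for every initial probability measure `ν` and every choice
of `μ₁, …, μₙ ∈ K` the maximal atom of `μₙ * ⋯ * μ₁ * ν` weighs less than `ε`;
in particular the maximal atom weight tends to `0` along every sequence from `K`. -/
theorem atoms_dissolving
    (X : Type) [MetricSpace X] [CompactSpace X] [MeasurableSpace X] [BorelSpace X]
    (K : Set (ProbabilityMeasure (X ≃ₜ X))) (hK : IsCompact K)
    (h : ∀ μ ∈ K, ¬ ∃ F F' : Set X, F.Finite ∧ F.Nonempty ∧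
      ∀ᵐ (f : X ≃ₜ X) ∂(μ : Measure (X ≃ₜ X)), f '' F = F') :
    (∀ ε : ℝ, 0 < ε → ∃ n : ℕ,
      ∀ ν : ProbabilityMeasure X, ∀ μseq : ℕ → ProbabilityMeasure (X ≃ₜ X),
        (∀ i, μseq i ∈ K) →
          maxAtom (iterConv μseq (ν : Measure X) n) < ENNReal.ofReal ε) ∧
    ∀ ν : ProbabilityMeasure X, ∀ μseq : ℕ → ProbabilityMeasure (X ≃ₜ X),
      (∀ i, μseq i ∈ K) →
        Filter.Tendsto (fun n : ℕ => maxAtom (iterConv μseq (ν : Measure X) n))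
          Filter.atTop (nhds 0) := by
  refine ⟨fun ε hε => ?_, fun ν μseq hμ => ?_⟩
  · obtain ⟨n, hn⟩ := AtomsDissolving.exists_forall_maxAtom_lt hK h
      (ENNReal.ofReal_pos.2 hε).ne'
    exact ⟨n, fun ν μseq hμ => hn n le_rfl ν μseq hμ⟩
  · rw [ENNReal.tendsto_nhds_zero]
    intro ε hε
    obtain ⟨n, hn⟩ := AtomsDissolving.exists_forall_maxAtom_lt hK h hε.ne'
    filter_upwards [Filter.eventually_ge_atTop n] with m hm
    exact (hn m hm ν μseq hμ).le
end
end

section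
/- Atoms dissolving (exponential part). Let K_X be a compact set of Borel probability measures on Homeo(X), and assume that for every μ ∈ K_X there is no measure with deterministic image. Then there exists λ < 1 such that for every n, every Borel probability measure ν on X, and every choice of μ₁, …, μₙ ∈ K_X one has 𝔐𝔞𝔵(μₙ * ⋯ * μ₁ * ν) < λⁿ. -/
open MeasureTheory
open scoped ENNReal

noncomputable section

section Atoms

variable {X : Type*}

/-- If two nonnegative families have the same square sum `S`, and integrating some `φ` bounded by
one against their squares distinguishes them by at least `η * S`, then their scalar product is
bounded away from `S`. -/
lemma sum_mul_le_of_le_abs_tsum_sub {ι : Type*} {a b φ : ι → ℝ} {S η : ℝ}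
    (ha0 : ∀ i, 0 ≤ a i) (hb0 : ∀ i, 0 ≤ b i)
    (ha : HasSum (fun i => a i ^ 2) S) (hb : HasSum (fun i => b i ^ 2) S)
    (hφ : ∀ i, |φ i| ≤ 1) (hη : 0 < η)
    (h : η * S ≤ |(∑' i, φ i * a i ^ 2) - ∑' i, φ i * b i ^ 2|) (T : Finset ι) :
    ∑ i ∈ T, a i * b i + η ^ 2 / 8 * S ≤ S := by
  have hab : Summable fun i => a i * b i := by
    refine Summable.of_nonneg_of_le (fun i => mul_nonneg (ha0 i) (hb0 i)) (fun i => ?_)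
      (ha.add hb).summable
    nlinarith [sq_nonneg (a i - b i), mul_nonneg (ha0 i) (hb0 i)]
  have hφs : ∀ {c : ι → ℝ}, HasSum (fun i => c i ^ 2) S → Summable fun i => φ i * c i ^ 2 := by
    intro c hc
    refine Summable.of_norm_bounded hc.summable fun i => ?_
    rw [norm_mul, Real.norm_eq_abs, Real.norm_eq_abs, abs_of_nonneg (sq_nonneg (c i))]
    exact mul_le_of_le_one_left (sq_nonneg _) (hφ i)
  obtain ⟨P, hP⟩ := hab
  have hTP : ∑ i ∈ T, a i * b i ≤ P :=
    sum_le_hasSum T (fun i _ => mul_nonneg (ha0 i) (hb0 i)) hP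
  have hm : HasSum (fun i => (a i - b i) ^ 2) (S + S - 2 * P) := by
    rw [show (fun i => (a i - b i) ^ 2) = fun i => a i ^ 2 + b i ^ 2 - 2 * (a i * b i) from
      funext fun i => by ring]
    exact (ha.add hb).sub (hP.mul_left 2)
  have hp : HasSum (fun i => (a i + b i) ^ 2) (S + S + 2 * P) := by
    rw [show (fun i => (a i + b i) ^ 2) = fun i => a i ^ 2 + b i ^ 2 + 2 * (a i * b i) from
      funext fun i => by ring]
    exact (ha.add hb).add (hP.mul_left 2)
  have hPS : P ≤ S := by
    have := hm.nonneg fun i => sq_nonneg _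
    linarith
  have hB : HasSum (fun i => 2 / η * (a i - b i) ^ 2 + η / 8 * (a i + b i) ^ 2)
      (2 / η * (S + S - 2 * P) + η / 8 * (S + S + 2 * P)) := (hm.mul_left _).add (hp.mul_left _)
  have hD := (hφs ha).hasSum.sub (hφs hb).hasSum
  have key : ∀ i, |φ i * a i ^ 2 - φ i * b i ^ 2| ≤
      2 / η * (a i - b i) ^ 2 + η / 8 * (a i + b i) ^ 2 := by
    intro i
    have h1 : |φ i * a i ^ 2 - φ i * b i ^ 2| ≤ |a i - b i| * |a i + b i| := by
      rw [show φ i * a i ^ 2 - φ i * b i ^ 2 = φ i * ((a i - b i) * (a i + b i)) by ring, abs_mul,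
        abs_mul]
      exact mul_le_of_le_one_left (by positivity) (hφ i)
    have h2 : 0 ≤ 2 / η * (|a i - b i| - η / 4 * |a i + b i|) ^ 2 := by positivity
    have h3 : 2 / η * (|a i - b i| - η / 4 * |a i + b i|) ^ 2 =
        2 / η * |a i - b i| ^ 2 + η / 8 * |a i + b i| ^ 2 - |a i - b i| * |a i + b i| := by
      field_simp
      ring
    rw [sq_abs, sq_abs] at h3
    linarith
  have hle : |(∑' i, φ i * a i ^ 2) - ∑' i, φ i * b i ^ 2| ≤
      2 / η * (S + S - 2 * P) + η / 8 * (S + S + 2 * P) := by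
    refine abs_le.2 ⟨?_, hasSum_le (fun i => (le_abs_self _).trans (key i)) hD hB⟩
    exact hasSum_le (fun i => neg_le.1 ((neg_le_abs _).trans (key i))) hB.neg hD
  have h4 : η * S / 2 ≤ 4 / η * (S - P) := by
    have : η / 8 * (S + S + 2 * P) ≤ η / 8 * (4 * S) := by gcongr; linarith
    have e : 2 / η * (S + S - 2 * P) = 4 / η * (S - P) := by ring
    linarith
  have h5 : η ^ 2 / 8 * S ≤ S - P := by
    have := mul_le_mul_of_nonneg_left h4 (by positivity : 0 ≤ η / 4)
    have e : η / 4 * (4 / η * (S - P)) = S - P := by field_simp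
    linarith
  linarith

lemma ENNReal.two_mul_mul_le_add_sq (a b : ℝ≥0∞) : 2 * a * b ≤ a ^ 2 + b ^ 2 := by
  wlog h : a ≤ b generalizing a b
  · rw [add_comm, mul_right_comm]
    exact this b a (le_of_not_ge h)
  obtain ⟨d, rfl⟩ := exists_add_of_le h
  calc 2 * a * (a + d) ≤ 2 * a * (a + d) + d ^ 2 := le_self_add
    _ = a ^ 2 + (a + d) ^ 2 := by ring

lemma maxAtom_sq_le_sqAtomMass [MeasurableSpace X] (ν : Measure X) :
    maxAtom ν ^ 2 ≤ sqAtomMass ν := by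
  have h : maxAtom ν ≤ sqAtomMass ν ^ (2⁻¹ : ℝ) := iSup_le fun x => by
    rw [ENNReal.le_rpow_inv_iff two_pos, ENNReal.rpow_two]
    exact ENNReal.le_tsum (f := fun x => ν {x} ^ 2) x
  rwa [ENNReal.le_rpow_inv_iff two_pos, ENNReal.rpow_two] at h

lemma sum_mul_measure_singleton_le_sqAtomMass [TopologicalSpace X] [MeasurableSpace X]
    (ν : Measure X) (f g : X ≃ₜ X) (T : Finset X) :
    ∑ y ∈ T, ν {f.symm y} * ν {g.symm y} ≤ sqAtomMass ν := by
  have hk : ∀ k : X ≃ₜ X, ∑' y, ν {k.symm y} ^ 2 = sqAtomMass ν := fun k =>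
    k.symm.toEquiv.tsum_eq fun x => ν {x} ^ 2
  have h2 : 2 * ∑ y ∈ T, ν {f.symm y} * ν {g.symm y} ≤ 2 * sqAtomMass ν := by
    calc 2 * ∑ y ∈ T, ν {f.symm y} * ν {g.symm y}
        ≤ ∑ y ∈ T, (ν {f.symm y} ^ 2 + ν {g.symm y} ^ 2) := by
          rw [Finset.mul_sum]
          refine Finset.sum_le_sum fun y _ => ?_
          rw [← mul_assoc]
          exact ENNReal.two_mul_mul_le_add_sq _ _
      _ ≤ 2 * sqAtomMass ν := by
          rw [Finset.sum_add_distrib, two_mul]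
          nth_rewrite 1 [← hk f]
          rw [← hk g]
          exact add_le_add (ENNReal.sum_le_tsum T) (ENNReal.sum_le_tsum T)
  exact (ENNReal.mul_le_mul_iff_right two_ne_zero ENNReal.ofNat_ne_top).1 h2

variable [MetricSpace X]

lemma isInducing_homeo_toContinuousMap :
    Topology.IsInducing fun f : X ≃ₜ X => (f : C(X, X)) := ⟨rfl⟩

/-- The homeomorphisms in two sets of `μ`-measure at least `η` push `p` to measures that differ by
at least `η` when tested against one continuous function with values in `[-1, 1]`. -/
def SpreadsBy [MeasurableSpace X] (η : ℝ) (μ : ProbabilityMeasure (X ≃ₜ X))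
    (p : ProbabilityMeasure X) : Prop :=
  ∃ φ : C(X, ℝ), (∀ x, |φ x| ≤ 1) ∧ ∃ U V : Set (X ≃ₜ X), MeasurableSet U ∧ MeasurableSet V ∧
    ENNReal.ofReal η ≤ (μ : Measure (X ≃ₜ X)) U ∧ ENNReal.ofReal η ≤ (μ : Measure (X ≃ₜ X)) V ∧
    ∀ f ∈ U, ∀ g ∈ V, η ≤ |(∫ x, φ (f x) ∂(p : Measure X)) - ∫ x, φ (g x) ∂(p : Measure X)|

lemma SpreadsBy.mono [MeasurableSpace X] {η η' : ℝ} {μ : ProbabilityMeasure (X ≃ₜ X)}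
    {p : ProbabilityMeasure X} (h : SpreadsBy η μ p) (hη : η' ≤ η) : SpreadsBy η' μ p := by
  obtain ⟨φ, hφ, U, V, hU, hV, hμU, hμV, hUV⟩ := h
  exact ⟨φ, hφ, U, V, hU, hV, (ENNReal.ofReal_le_ofReal hη).trans hμU,
    (ENNReal.ofReal_le_ofReal hη).trans hμV, fun f hf g hg => hη.trans (hUV f hf g hg)⟩

variable [CompactSpace X]

instance homeo_secondCountableTopology : SecondCountableTopology (X ≃ₜ X) :=
  isInducing_homeo_toContinuousMap.secondCountableTopology

instance homeo_pseudoMetrizableSpace : TopologicalSpace.PseudoMetrizableSpace (X ≃ₜ X) :=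
  isInducing_homeo_toContinuousMap.pseudoMetrizableSpace

lemma continuous_homeo_eval : Continuous fun q : (X ≃ₜ X) × X => q.1 q.2 := by
  have : Continuous fun q : (X ≃ₜ X) × X => ((q.1 : C(X, X)), q.2) :=
    (isInducing_homeo_toContinuousMap.continuous.comp continuous_fst).prodMk continuous_snd
  exact (continuous_eval (F := C(X, X))).comp this

variable [MeasurableSpace X] [BorelSpace X]

lemma measurable_map_homeo (ν : Measure X) [SFinite ν] :
    Measurable fun f : X ≃ₜ X => ν.map f := by
  refine Measure.measurable_of_measurable_coe _ fun s hs => ?_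
  have hE : MeasurableSet ((fun q : (X ≃ₜ X) × X => q.1 q.2) ⁻¹' s) :=
    continuous_homeo_eval.measurable hs
  convert measurable_measure_prodMk_left (ν := ν) hE using 2 with f
  exact Measure.map_apply f.continuous.measurable hs

lemma mconv_apply (μ : Measure (X ≃ₜ X)) (ν : Measure X) [SFinite ν] {s : Set X}
    (hs : MeasurableSet s) : mconv μ ν s = ∫⁻ f, ν.map f s ∂μ :=
  Measure.bind_apply hs (measurable_map_homeo ν).aemeasurable

instance mconv_isProbabilityMeasure (μ : Measure (X ≃ₜ X)) (ν : Measure X)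
    [IsProbabilityMeasure μ] [IsProbabilityMeasure ν] : IsProbabilityMeasure (mconv μ ν) := by
  refine ⟨?_⟩
  rw [mconv_apply μ ν .univ]
  simp [Measure.map_apply, Homeomorph.measurable]

lemma map_homeo_singleton (ν : Measure X) (f : X ≃ₜ X) (y : X) :
    ν.map f {y} = ν {f.symm y} := by
  rw [Measure.map_apply f.continuous.measurable (measurableSet_singleton y)]
  congr 1
  ext x
  simp [Homeomorph.eq_symm_apply]

lemma sqAtomMass_le_one (ν : Measure X) [IsProbabilityMeasure ν] : sqAtomMass ν ≤ 1 := by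
  calc sqAtomMass ν ≤ ∑' x, ν {x} :=
        ENNReal.tsum_le_tsum fun x => by
          rw [sq]; exact mul_le_of_le_one_left' prob_le_one
    _ ≤ ν Set.univ := (tsum_meas_le_meas_iUnion_of_disjoint ν measurableSet_singleton
        fun _ _ hxy => Set.disjoint_singleton.2 hxy).trans (measure_mono (Set.subset_univ _))
    _ = 1 := measure_univ

lemma exists_integral_comp_ne {μ : ProbabilityMeasure (X ≃ₜ X)} {p : ProbabilityMeasure X}
    (h : ¬ ∃ ν' : ProbabilityMeasure X,
      ∀ᵐ (f : X ≃ₜ X) ∂(μ : Measure (X ≃ₜ X)), (p : Measure X).map f = (ν' : Measure X)) :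
    ∃ f ∈ (μ : Measure (X ≃ₜ X)).support, ∃ g ∈ (μ : Measure (X ≃ₜ X)).support,
      ∃ φ : C(X, ℝ), (∀ x, |φ x| ≤ 1) ∧
        ∫ x, φ (f x) ∂(p : Measure X) ≠ ∫ x, φ (g x) ∂(p : Measure X) := by
  obtain ⟨g, hg⟩ := Measure.nonempty_support (IsProbabilityMeasure.ne_zero (μ : Measure (X ≃ₜ X)))
  by_contra! hc
  refine h ⟨p.map g.continuous.measurable.aemeasurable, ?_⟩
  filter_upwards [Measure.support_mem_ae (μ := (μ : Measure (X ≃ₜ X)))] with f hf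
  rw [ProbabilityMeasure.toMeasure_map]
  have := Measure.isProbabilityMeasure_map (μ := (p : Measure X))
    f.continuous.measurable.aemeasurable
  have := Measure.isProbabilityMeasure_map (μ := (p : Measure X))
    g.continuous.measurable.aemeasurable
  refine ext_of_forall_integral_eq_of_IsFiniteMeasure fun ψ => ?_
  rw [integral_map f.continuous.measurable.aemeasurable
      ψ.continuous.measurable.aestronglyMeasurable,
    integral_map g.continuous.measurable.aemeasurable
      ψ.continuous.measurable.aestronglyMeasurable]
  have hpos : 0 < ‖ψ‖ + 1 := by positivity
  have := hc f hf g hg ((‖ψ‖ + 1)⁻¹ • ψ.toContinuousMap) fun x => by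
    have := ψ.norm_coe_le_norm x
    rw [Real.norm_eq_abs] at this
    simp only [ContinuousMap.smul_apply, smul_eq_mul, abs_mul, abs_inv, abs_of_pos hpos]
    rw [inv_mul_le_iff₀ hpos]
    simp
    linarith
  simpa [integral_const_mul, hpos.ne'] using this

lemma eventually_spreadsBy {μ : ProbabilityMeasure (X ≃ₜ X)} {p : ProbabilityMeasure X}
    (h : ¬ ∃ ν' : ProbabilityMeasure X,
      ∀ᵐ (f : X ≃ₜ X) ∂(μ : Measure (X ≃ₜ X)), (p : Measure X).map f = (ν' : Measure X)) :
    ∃ η > 0, ∀ᶠ q in nhds (μ, p), SpreadsBy η q.1 q.2 := by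
  obtain ⟨f₁, hf₁, f₂, hf₂, φ, hφ, hne⟩ := exists_integral_comp_ne h
  set I : ProbabilityMeasure X → (X ≃ₜ X) → ℝ := fun q f => ∫ x, φ (f x) ∂(q : Measure X) with hI
  have hIc : ∀ f, Continuous fun q => I q f := fun f =>
    ProbabilityMeasure.continuous_integral_continuousMap (φ.comp (f : C(X, X)))
  obtain ⟨d, hd, hd'⟩ : ∃ d > 0, |I p f₁ - I p f₂| = 8 * d :=
    ⟨|I p f₁ - I p f₂| / 8, by have := abs_pos.2 (sub_ne_zero.2 hne); positivity, by ring⟩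
  have hC : Continuous fun f : X ≃ₜ X => φ.comp (f : C(X, X)) :=
    (ContinuousMap.continuous_postcomp φ).comp isInducing_homeo_toContinuousMap.continuous
  let U : (X ≃ₜ X) → Set (X ≃ₜ X) := fun g =>
    {f | dist (φ.comp (f : C(X, X))) (φ.comp (g : C(X, X))) < d}
  have hUo : ∀ g, IsOpen (U g) := fun g => isOpen_lt (hC.dist continuous_const) continuous_const
  have hUI : ∀ q g, ∀ f ∈ U g, |I q f - I q g| ≤ d := by
    intro q g f hf
    have hint : ∀ k : X ≃ₜ X, Integrable (fun x => φ (k x)) (q : Measure X) := fun k =>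
      (φ.continuous.comp k.continuous).integrable_of_hasCompactSupport
        (HasCompactSupport.of_compactSpace _)
    rw [hI]
    simp only
    rw [← integral_sub (hint f) (hint g), ← Real.norm_eq_abs]
    refine (norm_integral_le_of_norm_le_const (C := d) (.of_forall fun x => ?_)).trans (by simp)
    exact (ContinuousMap.dist_apply_le_dist (f := φ.comp (f : C(X, X)))
      (g := φ.comp (g : C(X, X))) x).trans (le_of_lt hf)
  have hpos : ∀ g ∈ (μ : Measure (X ≃ₜ X)).support, 0 < (μ : Measure (X ≃ₜ X)) (U g) := fun g hg =>
    (Measure.mem_support_iff_forall g).1 hg _ ((hUo g).mem_nhds (by simpa [U] using hd))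
  have hev : ∀ g ∈ (μ : Measure (X ≃ₜ X)).support, ∃ η > 0,
      ∀ᶠ μ' : ProbabilityMeasure (X ≃ₜ X) in nhds μ,
        ENNReal.ofReal η ≤ (μ' : Measure (X ≃ₜ X)) (U g) := by
    intro g hg
    obtain ⟨η, hη0, hη⟩ := ENNReal.lt_iff_exists_nnreal_btwn.1 (hpos g hg)
    refine ⟨η, by simpa using hη0, ?_⟩
    have := ProbabilityMeasure.le_liminf_measure_open_of_tendsto
      (Filter.tendsto_id (x := nhds μ)) (hUo g)
    filter_upwards [Filter.eventually_lt_of_lt_liminf (hη.trans_le this)] with μ' hμ'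
    simpa using hμ'.le
  obtain ⟨η₁, hη₁, he₁⟩ := hev f₁ hf₁
  obtain ⟨η₂, hη₂, he₂⟩ := hev f₂ hf₂
  refine ⟨min d (min η₁ η₂), by positivity, ?_⟩
  have hp : ∀ g, ∀ᶠ q in nhds p, |I q g - I p g| < d := fun g => by
    simpa [Real.dist_eq] using Metric.tendsto_nhds.1 ((hIc g).tendsto p) d hd
  rw [nhds_prod_eq]
  filter_upwards [(he₁.and he₂).prod_mk ((hp f₁).and (hp f₂))] with q hq
  obtain ⟨⟨h1, h2⟩, h3, h4⟩ := hq
  refine ⟨φ, hφ, U f₁, U f₂, (hUo _).measurableSet, (hUo _).measurableSet,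
    (ENNReal.ofReal_le_ofReal (by simp)).trans h1, (ENNReal.ofReal_le_ofReal (by simp)).trans h2,
    fun f hf g hg => (min_le_left _ _).trans ?_⟩
  have h5 := abs_le.1 (hUI q.2 _ _ hf)
  have h6 := abs_le.1 (hUI q.2 _ _ hg)
  rw [abs_lt] at h3 h4
  change d ≤ |I q.2 f - I q.2 g|
  rcases le_total 0 (I p f₁ - I p f₂) with h0 | h0
  · rw [abs_of_nonneg h0] at hd'
    exact le_trans (by linarith) (le_abs_self _)
  · rw [abs_of_nonpos h0] at hd'
    exact le_trans (by linarith) (neg_le_abs _)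

lemma IsCompact.exists_spreadsBy {K : Set (ProbabilityMeasure (X ≃ₜ X))} (hK : IsCompact K)
    (h : ∀ μ ∈ K, ¬ ∃ ν ν' : ProbabilityMeasure X,
      ∀ᵐ (f : X ≃ₜ X) ∂(μ : Measure (X ≃ₜ X)), (ν : Measure X).map f = (ν' : Measure X)) :
    ∃ η > 0, ∀ μ ∈ K, ∀ p, SpreadsBy η μ p := by
  have : ∃ η > 0, ∀ q ∈ K ×ˢ (Set.univ : Set (ProbabilityMeasure X)), SpreadsBy η q.1 q.2 := by
    refine (hK.prod isCompact_univ).induction_on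
      (p := fun s => ∃ η > 0, ∀ q ∈ s, SpreadsBy η q.1 q.2) ⟨1, one_pos, by simp⟩ ?_ ?_ ?_
    · rintro s t hst ⟨η, hη, ht⟩
      exact ⟨η, hη, fun q hq => ht q (hst hq)⟩
    · rintro s t ⟨η, hη, hs⟩ ⟨η', hη', ht⟩
      refine ⟨min η η', lt_min hη hη', ?_⟩
      rintro q (hq | hq)
      · exact (hs q hq).mono (min_le_left _ _)
      · exact (ht q hq).mono (min_le_right _ _)
    · rintro ⟨μ, p⟩ ⟨hμ, -⟩
      obtain ⟨η, hη, he⟩ := eventually_spreadsBy (μ := μ) (p := p) fun h' => h μ hμ ⟨p, h'⟩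
      exact ⟨_, mem_nhdsWithin_of_mem_nhds he, η, hη, fun q hq => hq⟩
  obtain ⟨η, hη, hs⟩ := this
  exact ⟨η, hη, fun μ hμ p => hs (μ, p) ⟨hμ, trivial⟩⟩

lemma sum_mul_measure_singleton_le {η : ℝ} (hη : 0 < η) {ν : Measure X} [IsProbabilityMeasure ν]
    (h0 : sqAtomMass ν ≠ 0) {φ : C(X, ℝ)} (hφ : ∀ x, |φ x| ≤ 1) {p : PMF X}
    (hp : ∀ x, p x = ν {x} ^ 2 * (sqAtomMass ν)⁻¹) {f g : X ≃ₜ X}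
    (h : η ≤ |(∫ x, φ (f x) ∂p.toMeasure) - ∫ x, φ (g x) ∂p.toMeasure|) (T : Finset X) :
    ∑ y ∈ T, ν {f.symm y} * ν {g.symm y} + ENNReal.ofReal (η ^ 2 / 8) * sqAtomMass ν
      ≤ sqAtomMass ν := by
  have hfin : sqAtomMass ν ≠ ⊤ := ((sqAtomMass_le_one ν).trans_lt ENNReal.one_lt_top).ne
  set S : ℝ := (sqAtomMass ν).toReal with hS
  have hSpos : 0 < S := ENNReal.toReal_pos h0 hfin
  have hsum : HasSum (fun x => ν.real {x} ^ 2) S := by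
    have hne : ∀ x, ν {x} ^ 2 ≠ ⊤ := fun x => by finiteness
    rw [hS, sqAtomMass, ENNReal.tsum_toReal_eq hne]
    simpa only [ENNReal.toReal_pow, Measure.real] using
      ENNReal.hasSum_toReal (f := fun x => ν {x} ^ 2) hfin
  have hsum' : ∀ k : X ≃ₜ X, HasSum (fun y => ν.real {k.symm y} ^ 2) S := fun k =>
    (k.symm.toEquiv.hasSum_iff (f := fun x => ν.real {x} ^ 2)).2 hsum
  have hint : ∀ k : X ≃ₜ X, S * ∫ x, φ (k x) ∂p.toMeasure =
      ∑' y, φ y * ν.real {k.symm y} ^ 2 := by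
    intro k
    rw [PMF.integral_eq_tsum p (fun x => φ (k x)) ((φ.continuous.comp k.continuous).integrable_of_hasCompactSupport
        (HasCompactSupport.of_compactSpace _)), ← tsum_mul_left,
      ← k.toEquiv.tsum_eq (fun y => φ y * ν.real {k.symm y} ^ 2)]
    refine tsum_congr fun x => ?_
    simp only [hp, ENNReal.toReal_mul, ENNReal.toReal_inv, ENNReal.toReal_pow, ← hS, smul_eq_mul,
      Homeomorph.coe_toEquiv, Homeomorph.symm_apply_apply, Measure.real]
    field_simp
  have key := sum_mul_le_of_le_abs_tsum_sub (a := fun y => ν.real {f.symm y})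
    (b := fun y => ν.real {g.symm y}) (φ := φ) (fun _ => measureReal_nonneg)
    (fun _ => measureReal_nonneg) (hsum' f) (hsum' g) hφ hη (by
      rw [← hint f, ← hint g, ← mul_sub, abs_mul, abs_of_pos hSpos, mul_comm]
      gcongr) T
  have e1 : ∑ y ∈ T, ν {f.symm y} * ν {g.symm y} =
      ENNReal.ofReal (∑ y ∈ T, ν.real {f.symm y} * ν.real {g.symm y}) := by
    rw [ENNReal.ofReal_sum_of_nonneg fun _ _ => by positivity]
    refine Finset.sum_congr rfl fun y _ => ?_
    rw [ENNReal.ofReal_mul measureReal_nonneg, ofReal_measureReal, ofReal_measureReal]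
  have e2 : sqAtomMass ν = ENNReal.ofReal S := (ENNReal.ofReal_toReal hfin).symm
  rw [e1, e2, ← ENNReal.ofReal_mul (by positivity), ← ENNReal.ofReal_add (by positivity)
    (by positivity)]
  exact ENNReal.ofReal_le_ofReal key

lemma sqAtomMass_mconv_add_le {η : ℝ} (hη : 0 < η) {μ : ProbabilityMeasure (X ≃ₜ X)}
    (hμ : ∀ p, SpreadsBy η μ p) (ν : Measure X) [IsProbabilityMeasure ν] :
    sqAtomMass (mconv (μ : Measure (X ≃ₜ X)) ν) + ENNReal.ofReal (η ^ 4 / 8) * sqAtomMass ν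
      ≤ sqAtomMass ν := by
  have hfin : sqAtomMass ν ≠ ⊤ := ((sqAtomMass_le_one ν).trans_lt ENNReal.one_lt_top).ne
  set m : Measure (X ≃ₜ X) := (μ : Measure (X ≃ₜ X))
  have hmeas : ∀ y, Measurable fun f : X ≃ₜ X => ν {f.symm y} := fun y => by
    simpa only [Function.comp_def, map_homeo_singleton] using
      (Measure.measurable_coe (measurableSet_singleton y)).comp (measurable_map_homeo ν)
  have hw : ∀ y, mconv m ν {y} ^ 2 = ∫⁻ f, ∫⁻ g, ν {f.symm y} * ν {g.symm y} ∂m ∂m := by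
    intro y
    simp_rw [lintegral_const_mul _ (hmeas y), mconv_apply m ν (measurableSet_singleton y),
      map_homeo_singleton]
    rw [lintegral_mul_const _ (hmeas y), sq]
  have hsum : ∀ T : Finset X, ∑ y ∈ T, mconv m ν {y} ^ 2 =
      ∫⁻ f, ∫⁻ g, ∑ y ∈ T, ν {f.symm y} * ν {g.symm y} ∂m ∂m := by
    intro T
    simp_rw [hw]
    rw [← lintegral_finsetSum _ fun y _ => by
      simp_rw [lintegral_const_mul _ (hmeas y)]; exact (hmeas y).mul_const _]
    refine lintegral_congr fun f => ?_
    rw [← lintegral_finsetSum _ fun y _ => (hmeas y).const_mul _]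
  rcases eq_or_ne (sqAtomMass ν) 0 with h0 | h0
  · rw [h0, mul_zero, add_zero, sqAtomMass, ENNReal.tsum_eq_iSup_sum]
    refine iSup_le fun T => ?_
    rw [hsum, ← h0]
    calc _ ≤ ∫⁻ _, ∫⁻ _, sqAtomMass ν ∂m ∂m := by
          gcongr with f g; exact sum_mul_measure_singleton_le_sqAtomMass ν f g T
      _ = _ := by simp
  set p : PMF X := PMF.normalize (fun x => ν {x} ^ 2) h0 hfin
  obtain ⟨φ, hφ, U, V, hU, hV, hmU, hmV, hUV⟩ := hμ ⟨p.toMeasure, inferInstance⟩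
  set c : ℝ≥0∞ := ENNReal.ofReal (η ^ 2 / 8) * sqAtomMass ν with hc
  have hpt : ∀ (T : Finset X) (f g : X ≃ₜ X), ∑ y ∈ T, ν {f.symm y} * ν {g.symm y} +
      U.indicator 1 f * (V.indicator 1 g * c) ≤ sqAtomMass ν := by
    intro T f g
    by_cases hf : f ∈ U
    · by_cases hg : g ∈ V
      · simpa [hf, hg] using
          sum_mul_measure_singleton_le hη h0 hφ (fun x => PMF.normalize_apply _ _ x)
            (hUV f hf g hg) T
      · simpa [hg] using sum_mul_measure_singleton_le_sqAtomMass ν f g T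
    · simpa [hf] using sum_mul_measure_singleton_le_sqAtomMass ν f g T
  have hVm : Measurable (V.indicator (1 : (X ≃ₜ X) → ℝ≥0∞)) := measurable_one.indicator hV
  have hUm : Measurable (U.indicator (1 : (X ≃ₜ X) → ℝ≥0∞)) := measurable_one.indicator hU
  have hT : ∀ T : Finset X, ∑ y ∈ T, mconv m ν {y} ^ 2 + m U * (m V * c) ≤ sqAtomMass ν := by
    intro T
    calc _ = ∫⁻ f, ∫⁻ g, (∑ y ∈ T, ν {f.symm y} * ν {g.symm y} +
              U.indicator 1 f * (V.indicator 1 g * c)) ∂m ∂m := by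
          have e : ∀ f : X ≃ₜ X, ∫⁻ g, (∑ y ∈ T, ν {f.symm y} * ν {g.symm y} +
              U.indicator 1 f * (V.indicator 1 g * c)) ∂m =
              ∫⁻ g, ∑ y ∈ T, ν {f.symm y} * ν {g.symm y} ∂m +
                U.indicator 1 f * (m V * c) := by
            intro f
            rw [lintegral_add_right _ ((hVm.mul_const c).const_mul _),
              lintegral_const_mul _ (hVm.mul_const c), lintegral_mul_const _ hVm,
              lintegral_indicator_one hV]
          simp_rw [e]
          rw [lintegral_add_right _ (hUm.mul_const _), lintegral_mul_const _ hUm,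
            lintegral_indicator_one hU, hsum]
      _ ≤ ∫⁻ _, ∫⁻ _, sqAtomMass ν ∂m ∂m := by
          gcongr with f g; exact hpt T f g
      _ = _ := by simp
  calc sqAtomMass (mconv m ν) + ENNReal.ofReal (η ^ 4 / 8) * sqAtomMass ν
      ≤ sqAtomMass (mconv m ν) + m U * (m V * c) := by
        refine add_le_add le_rfl ?_
        calc ENNReal.ofReal (η ^ 4 / 8) * sqAtomMass ν
            = ENNReal.ofReal η * (ENNReal.ofReal η * c) := by
              rw [hc, ← mul_assoc, ← mul_assoc, ← ENNReal.ofReal_mul hη.le,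
                ← ENNReal.ofReal_mul (by positivity)]
              congr 2
              ring
          _ ≤ _ := by gcongr
    _ ≤ sqAtomMass ν := by
        rw [sqAtomMass, ENNReal.tsum_eq_iSup_sum, ENNReal.iSup_add]
        exact iSup_le hT

end Atoms

/-- **Atoms dissolving, exponential part** (Theorem 1.8, second part).
If no `μ ∈ K` admits a probability measure with a deterministic image, then there is
`λ < 1` such that for every `n ≥ 1`, every initial probability measure `ν` and every choice
of `μ₁, …, μₙ ∈ K` one has `𝔐𝔞𝔵(μₙ * ⋯ * μ₁ * ν) < λⁿ`. -/
theorem atoms_dissolving_exponential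
    (X : Type) [MetricSpace X] [CompactSpace X] [MeasurableSpace X] [BorelSpace X]
    (K : Set (ProbabilityMeasure (X ≃ₜ X))) (hK : IsCompact K)
    (h : ∀ μ ∈ K, ¬ ∃ ν ν' : ProbabilityMeasure X,
      ∀ᵐ (f : X ≃ₜ X) ∂(μ : Measure (X ≃ₜ X)), (ν : Measure X).map f = (ν' : Measure X)) :
    ∃ lam : ℝ≥0∞, lam < 1 ∧
      ∀ n : ℕ, 0 < n →
        ∀ ν : ProbabilityMeasure X, ∀ μseq : ℕ → ProbabilityMeasure (X ≃ₜ X),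
          (∀ i, μseq i ∈ K) →
            maxAtom (iterConv μseq (ν : Measure X) n) < lam ^ n := by
  obtain ⟨η, hη, hs⟩ := hK.exists_spreadsBy h
  set κ : ℝ := min (η ^ 4 / 8) 1 with hκ
  have hκ0 : 0 < κ := by positivity
  have hκ1 : κ ≤ 1 := min_le_right _ _
  have step : ∀ μ ∈ K, ∀ ν : Measure X, IsProbabilityMeasure ν →
      sqAtomMass (mconv (μ : Measure (X ≃ₜ X)) ν) ≤ ENNReal.ofReal (1 - κ) * sqAtomMass ν := by
    intro μ hμ ν hν
    have hfin : sqAtomMass ν ≠ ⊤ := ((sqAtomMass_le_one ν).trans_lt ENNReal.one_lt_top).ne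
    have hle : sqAtomMass (mconv (μ : Measure (X ≃ₜ X)) ν) + ENNReal.ofReal κ * sqAtomMass ν ≤
        sqAtomMass ν := by
      refine le_trans ?_ (sqAtomMass_mconv_add_le hη (hs μ hμ) ν)
      gcongr
      exact min_le_left _ _
    rw [ENNReal.ofReal_sub _ hκ0.le, ENNReal.ofReal_one, ENNReal.sub_mul fun _ _ => hfin, one_mul]
    exact ENNReal.le_sub_of_add_le_right (ENNReal.mul_ne_top ENNReal.ofReal_ne_top hfin) hle
  refine ⟨ENNReal.ofReal (1 - κ / 2), ENNReal.ofReal_lt_one.2 (by linarith), ?_⟩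
  intro n hn ν μseq hμ
  have hind : ∀ n, IsProbabilityMeasure (iterConv μseq (ν : Measure X) n) ∧
      sqAtomMass (iterConv μseq (ν : Measure X) n) ≤ ENNReal.ofReal (1 - κ) ^ n := by
    intro n
    induction n with
    | zero => exact ⟨inferInstanceAs (IsProbabilityMeasure (ν : Measure X)), by
        simpa [iterConv] using sqAtomMass_le_one (ν : Measure X)⟩
    | succ n ih =>
      have := ih.1
      refine ⟨mconv_isProbabilityMeasure _ _, (step _ (hμ n) _ ih.1).trans ?_⟩
      rw [pow_succ']
      gcongr
      exact ih.2
  refine lt_of_not_ge fun hle => (pow_le_pow_left' hle 2).not_gt ?_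
  calc _ ≤ ENNReal.ofReal (1 - κ) ^ n := (maxAtom_sq_le_sqAtomMass _).trans (hind n).2
    _ < (ENNReal.ofReal (1 - κ / 2) ^ 2) ^ n := by
        rw [← ENNReal.ofReal_pow (by linarith), ← ENNReal.ofReal_pow (by linarith : 0 ≤ 1 - κ / 2),
          ← ENNReal.ofReal_pow (sq_nonneg _), ENNReal.ofReal_lt_ofReal_iff
          (pow_pos (pow_pos (by linarith : 0 < 1 - κ / 2) _) _)]
        exact pow_lt_pow_left₀ (by nlinarith) (by linarith) hn.ne'
    _ = _ := by rw [← pow_mul, ← pow_mul, mul_comm]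
end
end
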